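/- Let x ∈ [0,1) and α ∈ [0,1) with (x,α) ≠ (0,0). Then the set {β ∈ (1,∞) : the orbit of x under T_{α,β} is μ_{α,β}-normal} has full Lebesgue measure in (1,∞), i.e., its complement in (1,∞) is a Lebesgue-null set. -/

import Mathlib

open MeasureTheory Filter

/-- The map `x ↦ β·x + α mod 1` (fractional part of `β·x + α`). -/
noncomputable def Tab (α β : ℝ) (x : ℝ) : ℝ := Int.fract (β * x + α)

/-- The coding sequence of `x` under `T_{α,β}`: `i^{α,β}_n(x) = ⌊β·T^n(x) + α⌋`. -/
noncomputable def code (α β : ℝ) (x : ℝ) : ℕ → ℕ :=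
  fun n => (⌊β * (Tab α β)^[n] x + α⌋).toNat

/-- Unnormalized Parry density. -/
noncomputable def parryG (α β : ℝ) (x : ℝ) : ℝ :=
  ∑' n : ℕ, ((if x < (Tab α β)^[n] 1 then (1 : ℝ) else 0)
    - (if x < (Tab α β)^[n] 0 then (1 : ℝ) else 0)) / β ^ (n + 1)

/-- Normalization constant. -/
noncomputable def parryN (α β : ℝ) : ℝ := ∫ x in Set.Icc (0 : ℝ) 1, parryG α β x

/-- The Parry measure `μ_{α,β}`, absolutely continuous w.r.t. Lebesgue on `[0,1]`. -/
noncomputable def parryMeasure (α β : ℝ) : Measure ℝ :=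
  (volume.restrict (Set.Icc (0 : ℝ) 1)).withDensity
    (fun x => ENNReal.ofReal (parryG α β x / parryN α β))

/-- The orbit of `x` under `T` is `μ`-normal. -/
def IsNormalOrbit (T : ℝ → ℝ) (μ : Measure ℝ) (x : ℝ) : Prop :=
  ∀ f : ℝ → ℝ, ContinuousOn f (Set.Icc 0 1) →
    Tendsto (fun n : ℕ => (n : ℝ)⁻¹ * ∑ m ∈ Finset.range n, f (T^[m] x)) atTop
      (nhds (∫ y, f y ∂μ))

/-- Left shift on `ℕ^ℕ`. -/
def shiftN (y : ℕ → ℕ) : ℕ → ℕ := fun n => y (n + 1)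

open scoped Topology ENNReal NNReal

/-- code words -/
noncomputable def cd (α : ℝ) : ℕ → ℝ → ℝ → List ℤ
  | 0, _, _ => []
  | n+1, β, y => ⌊β*y+α⌋ :: cd α n β (Tab α β y)

lemma cd_add (α β : ℝ) (m k : ℕ) (y : ℝ) :
    cd α (m+k) β y = cd α m β y ++ cd α k β ((Tab α β)^[m] y) := by
  induction m generalizing y with
  | zero => simp [cd]
  | succ m ih =>
    rw [Nat.succ_add_eq_add_succ, Nat.add_succ, cd, cd, ih]
    simp

lemma cd_length (α β : ℝ) (m : ℕ) (y : ℝ) : (cd α m β y).length = m := by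
  induction m generalizing y with
  | zero => simp [cd]
  | succ m ih => simp [cd, ih]

lemma cd_succ_eq_iff (α β β' : ℝ) (m : ℕ) (y : ℝ) :
    cd α (m+1) β y = cd α (m+1) β' y ↔ cd α m β y = cd α m β' y ∧
      ⌊β*((Tab α β)^[m] y)+α⌋ = ⌊β'*((Tab α β')^[m] y)+α⌋ := by
  rw [cd_add, cd_add]
  constructor
  · intro h
    have := List.append_inj h (by simp [cd_length])
    refine ⟨this.1, by simpa [cd] using this.2⟩
  · rintro ⟨h1, h2⟩
    simp [cd, h1, h2]

lemma cd_prefix {α β β' : ℝ} {m k : ℕ} {y : ℝ}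
    (h : cd α (m+k) β y = cd α (m+k) β' y) : cd α m β y = cd α m β' y := by
  rw [cd_add, cd_add] at h
  exact (List.append_inj h (by simp [cd_length])).1

lemma Tab_nonneg (α β y : ℝ) : 0 ≤ Tab α β y := Int.fract_nonneg _
lemma Tab_lt (α β y : ℝ) : Tab α β y < 1 := Int.fract_lt_one _

lemma iter_mem_Icc (α β : ℝ) {y : ℝ} (hy : y ∈ Set.Icc (0:ℝ) 1) (n : ℕ) :
    (Tab α β)^[n] y ∈ Set.Icc (0:ℝ) 1 := by
  cases n with
  | zero => simpa using hy
  | succ n => rw [Function.iterate_succ_apply']; exact ⟨Tab_nonneg _ _ _, (Tab_lt _ _ _).le⟩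

lemma iter_mem_Ico (α β : ℝ) {y : ℝ} (hy : y ∈ Set.Ico (0:ℝ) 1) (n : ℕ) :
    (Tab α β)^[n] y ∈ Set.Ico (0:ℝ) 1 := by
  cases n with
  | zero => simpa using hy
  | succ n => rw [Function.iterate_succ_apply']; exact ⟨Tab_nonneg _ _ _, (Tab_lt _ _ _)⟩

lemma Tab_eq (α β y : ℝ) : Tab α β y = β*y+α-⌊β*y+α⌋ := rfl

lemma diff_step {α β β' y : ℝ} {n : ℕ} (h : cd α (n+1) β y = cd α (n+1) β' y) :
    (Tab α β')^[n+1] y - (Tab α β)^[n+1] y =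
      β * ((Tab α β')^[n] y - (Tab α β)^[n] y) + (β' - β) * (Tab α β')^[n] y := by
  rw [cd_succ_eq_iff] at h
  rw [Function.iterate_succ_apply', Function.iterate_succ_apply', Tab_eq, Tab_eq, h.2]
  ring

lemma diff_bounds {α β β' y : ℝ} {n : ℕ} (hy : y ∈ Set.Icc (0:ℝ) 1) (hβ : 1 < β) (hb : β ≤ β')
    (h : cd α n β y = cd α n β' y) :
    0 ≤ (Tab α β')^[n] y - (Tab α β)^[n] y ∧
    ((Tab α β')^[n] y - (Tab α β)^[n] y) * (β-1) ≤ (β' - β) * (β^n - 1) := by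
  induction n with
  | zero => simp
  | succ n ih =>
    obtain ⟨h1, h2⟩ := ih (cd_prefix h)
    rw [diff_step h]
    have h3 := iter_mem_Icc α β' hy n
    have hb' : 0 ≤ β' - β := by linarith
    constructor
    · have := h3.1
      positivity
    · have e1 : β * (((Tab α β')^[n] y - (Tab α β)^[n] y) * (β-1)) ≤ β * ((β' - β) * (β^n - 1)) :=
        mul_le_mul_of_nonneg_left h2 (by linarith)
      have e2 : (β' - β) * (β-1) * (Tab α β')^[n] y ≤ (β' - β) * (β-1) * 1 :=
        mul_le_mul_of_nonneg_left h3.2 (mul_nonneg hb' (by linarith))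
      rw [pow_succ]
      nlinarith

lemma diff_lower {α β β' y c : ℝ} {n : ℕ} (hy : y ∈ Set.Icc (0:ℝ) 1)
    (hβ : 1 < β) (hb : β ≤ β') (hc : c ≤ y ∨ (y = 0 ∧ α ∈ Set.Ico (0:ℝ) 1 ∧ c ≤ α))
    (h : cd α (n+2) β y = cd α (n+2) β' y) :
    c * (β' - β) * β^n ≤ (Tab α β')^[n+2] y - (Tab α β)^[n+2] y := by
  have hb' : 0 ≤ β' - β := by linarith
  induction n with
  | zero =>
    rw [diff_step h, diff_step (n := 0) (cd_prefix (k := 1) h)]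
    have h3 := iter_mem_Icc α β' hy 1
    simp only [Function.iterate_zero, id, sub_self, mul_zero, zero_add, pow_zero, mul_one]
    rcases hc with hc | ⟨h0, h1, h2⟩
    · have := hy.1
      have e1 : c * (β' - β) ≤ 1 * ((β' - β) * y) := by nlinarith
      have e2 : 1 * ((β' - β) * y) ≤ β * ((β' - β) * y) := by gcongr
      have e3 : 0 ≤ (β' - β) * (Tab α β')^[1] y := mul_nonneg hb' h3.1
      linarith
    · subst h0
      simp only [Function.iterate_one, Tab, mul_zero, zero_add]
      rw [Int.fract_eq_self.mpr ⟨h1.1, h1.2⟩]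
      nlinarith
  | succ n ih =>
    rw [diff_step h]
    have h3 := iter_mem_Icc α β' hy (n+2)
    have e3 : 0 ≤ (β' - β) * (Tab α β')^[n+2] y := mul_nonneg hb' h3.1
    have := mul_le_mul_of_nonneg_left (ih (cd_prefix (k := 1) h)) (show 0 ≤ β by linarith)
    rw [pow_succ]
    linarith

lemma cd_ordConn {α b1 b2 b3 y : ℝ} {n : ℕ} (hy : y ∈ Set.Icc (0:ℝ) 1) (h1 : 1 < b1)
    (h12 : b1 ≤ b2) (h23 : b2 ≤ b3) (h : cd α n b1 y = cd α n b3 y) :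
    cd α n b2 y = cd α n b1 y := by
  induction n with
  | zero => simp [cd]
  | succ n ih =>
    have ih' := ih (cd_prefix h)
    rw [cd_succ_eq_iff] at h ⊢
    refine ⟨ih', le_antisymm ?_ ?_⟩
    · rw [h.2]
      have := (diff_bounds hy (h1.trans_le h12) h23 (ih'.trans h.1)).1
      have h3 := iter_mem_Icc α b2 hy n
      have h4 := iter_mem_Icc α b3 hy n
      apply Int.floor_le_floor
      have : b2 * (Tab α b2)^[n] y ≤ b3 * (Tab α b3)^[n] y :=
        mul_le_mul h23 (by linarith) h3.1 (by linarith)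
      linarith
    · have := (diff_bounds hy h1 h12 ih'.symm).1
      have h3 := iter_mem_Icc α b1 hy n
      apply Int.floor_le_floor
      have : b1 * (Tab α b1)^[n] y ≤ b2 * (Tab α b2)^[n] y :=
        mul_le_mul h12 (by linarith) h3.1 (by linarith)
      linarith

/-- generic parameters -/
def Gen (α β : ℝ) : Prop := 1 < β ∧ (∀ j, (Tab α β)^[j+1] 1 ≠ 0) ∧
  (α = 0 ∨ ∀ j, (Tab α β)^[j+1] 0 ≠ 0)

lemma countable_hit {α y : ℝ} (hα : α ∈ Set.Ico (0:ℝ) 1) (hy : y ∈ Set.Icc (0:ℝ) 1)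
    (hya : 0 < y ∨ (y = 0 ∧ 0 < α)) :
    {β : ℝ | 1 < β ∧ ∃ j, (Tab α β)^[j+2] y = 0}.Countable := by
  have : {β : ℝ | 1 < β ∧ ∃ j, (Tab α β)^[j+2] y = 0} ⊆
      ⋃ (j : ℕ), ⋃ (w : List ℤ), {β | 1 < β ∧ cd α (j+2) β y = w ∧ (Tab α β)^[j+2] y = 0} := by
    rintro β ⟨h1, j, hj⟩
    simp only [Set.mem_iUnion]
    exact ⟨j, _, h1, rfl, hj⟩
  refine Set.Countable.mono this (Set.countable_iUnion fun j => Set.countable_iUnion fun w => ?_)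
  apply Set.Subsingleton.countable
  have key : ∀ β β' : ℝ, 1 < β → β < β' → cd α (j+2) β y = cd α (j+2) β' y →
      (Tab α β)^[j+2] y = 0 → (Tab α β')^[j+2] y = 0 → False := by
    intro β β' h1 h2 h3 h4 h5
    obtain ⟨c, hc, hc'⟩ : ∃ c : ℝ, 0 < c ∧ (c ≤ y ∨ (y = 0 ∧ α ∈ Set.Ico (0:ℝ) 1 ∧ c ≤ α)) := by
      rcases hya with h | h
      · exact ⟨y, h, Or.inl le_rfl⟩
      · exact ⟨α, h.2, Or.inr ⟨h.1, hα, le_rfl⟩⟩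
    have := diff_lower hy h1 h2.le hc' h3
    rw [h4, h5] at this
    have : 0 < c * (β' - β) * β^j := by
      have : 0 < β' - β := by linarith
      positivity
    linarith
  rintro β ⟨h1, h2, h3⟩ β' ⟨h1', h2', h3'⟩
  rcases lt_trichotomy β β' with h | h | h
  · exact (key _ _ h1 h (h2.trans h2'.symm) h3 h3').elim
  · exact h
  · exact (key _ _ h1' h (h2'.trans h2.symm) h3' h3).elim

lemma countable_notGen {α : ℝ} (hα : α ∈ Set.Ico (0:ℝ) 1) :
    {β : ℝ | 1 < β ∧ ¬ Gen α β}.Countable := by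
  have h1 : {β : ℝ | 1 < β ∧ Tab α β 1 = 0}.Countable := by
    have : {β : ℝ | 1 < β ∧ Tab α β 1 = 0} ⊆ Set.range (fun k : ℤ => (k:ℝ) - α) := by
      rintro β ⟨_, h⟩
      rw [Tab_eq] at h
      exact ⟨⌊β*1+α⌋, by simp only; linarith⟩
    exact (Set.countable_range _).mono this
  have h2 := countable_hit hα (y := 1) (by simp) (Or.inl one_pos)
  have h3 : {β : ℝ | 1 < β ∧ ¬ (α = 0 ∨ ∀ j, (Tab α β)^[j+1] 0 ≠ 0)}.Countable := by
    by_cases h0 : α = 0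
    · simp [h0]
    · have hpos : 0 < α := lt_of_le_of_ne hα.1 (Ne.symm h0)
      refine (countable_hit hα (y := 0) (by simp) (Or.inr ⟨rfl, hpos⟩)).mono ?_
      rintro β ⟨hb, h⟩
      push Not at h
      obtain ⟨_, j, hj⟩ := h
      refine ⟨hb, ?_⟩
      cases j with
      | zero =>
        simp only [zero_add, Function.iterate_one, Tab, mul_zero] at hj
        rw [Int.fract_eq_self.mpr ⟨hα.1, hα.2⟩] at hj
        exact absurd hj h0
      | succ j => exact ⟨j, hj⟩
  refine ((h1.union h2).union h3).mono ?_
  rintro β ⟨hb, h⟩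
  unfold Gen at h
  by_cases h4 : ∀ j, (Tab α β)^[j+1] 1 ≠ 0
  · exact Or.inr ⟨hb, fun h5 => h ⟨hb, h4, h5⟩⟩
  · push Not at h4
    obtain ⟨j, hj⟩ := h4
    cases j with
    | zero => exact Or.inl (Or.inl ⟨hb, by simpa using hj⟩)
    | succ j => exact Or.inl (Or.inr ⟨hb, j, hj⟩)

open scoped Topology

lemma floor_ev {α β0 y0 : ℝ} (h : Tab α β0 y0 ≠ 0) :
    ∀ᶠ p in 𝓝 (β0, y0), ⌊p.1 * p.2 + α⌋ = ⌊β0 * y0 + α⌋ := by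
  have hc : Tendsto (fun p : ℝ × ℝ => p.1 * p.2 + α) (𝓝 (β0, y0)) (𝓝 (β0 * y0 + α)) :=
    Continuous.tendsto' (by fun_prop) _ _ rfl
  have h1 : (⌊β0 * y0 + α⌋ : ℝ) < β0 * y0 + α := by
    have := lt_of_le_of_ne (Tab_nonneg α β0 y0) (Ne.symm h)
    rw [Tab_eq] at this
    linarith
  filter_upwards [hc.eventually (lt_mem_nhds h1),
    hc.eventually (gt_mem_nhds (Int.lt_floor_add_one (β0 * y0 + α)))] with p hp1 hp2
  exact Int.floor_eq_iff.mpr ⟨hp1.le, hp2⟩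

lemma tab_tendsto {α β0 y0 : ℝ} (h : Tab α β0 y0 ≠ 0) :
    Tendsto (fun p : ℝ × ℝ => (p.1, Tab α p.1 p.2)) (𝓝 (β0, y0)) (𝓝 (β0, Tab α β0 y0)) := by
  have hc : Tendsto (fun p : ℝ × ℝ => (p.1, p.1 * p.2 + α - ⌊β0 * y0 + α⌋)) (𝓝 (β0, y0))
      (𝓝 (β0, Tab α β0 y0)) := Continuous.tendsto' (by fun_prop) _ _ rfl
  refine hc.congr' ?_
  filter_upwards [floor_ev h] with p hp
  rw [Tab_eq, hp]

lemma cont_claim {α β0 : ℝ} (κ : ℕ) : ∀ y0 : ℝ, (∀ j, (Tab α β0)^[j+1] y0 ≠ 0) →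
    ∀ᶠ p in 𝓝 (β0, y0), cd α κ p.1 p.2 = cd α κ β0 y0 := by
  induction κ with
  | zero => intro y0 _; simp [cd]
  | succ κ ih =>
    intro y0 h
    have h0 : Tab α β0 y0 ≠ 0 := by simpa using h 0
    have := (tab_tendsto h0).eventually (ih (Tab α β0 y0) (fun j => by
      have := h (j+1)
      rwa [Function.iterate_succ_apply] at this))
    filter_upwards [this, floor_ev h0] with p hp1 hp2
    simp only [cd, hp2, hp1]

lemma zero_side {α β0 : ℝ} (hg : Gen α β0) (κ : ℕ) :
    ∃ w, ∀ᶠ p : ℝ × ℝ in 𝓝 (β0, 0), 0 ≤ p.2 → cd α κ p.1 p.2 = w := by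
  rcases hg.2.2 with h0 | h0
  · subst h0
    induction κ with
    | zero => exact ⟨[], by simp [cd]⟩
    | succ κ ih =>
      obtain ⟨w, hw⟩ := ih
      refine ⟨0 :: w, ?_⟩
      have hc : Tendsto (fun p : ℝ × ℝ => (p.1, p.1 * p.2)) (𝓝 (β0, 0)) (𝓝 (β0, 0)) :=
        Continuous.tendsto' (by fun_prop) _ _ (by simp)
      have hc2 : Tendsto (fun p : ℝ × ℝ => p.1 * p.2) (𝓝 (β0, 0)) (𝓝 0) :=
        Continuous.tendsto' (by fun_prop) _ _ (by simp)
      have hc3 : Tendsto (fun p : ℝ × ℝ => p.1) (𝓝 (β0, 0)) (𝓝 β0) :=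
        Continuous.tendsto' (by fun_prop) _ _ (by simp)
      filter_upwards [hc.eventually hw, hc2.eventually (gt_mem_nhds one_pos),
        hc3.eventually (lt_mem_nhds hg.1)] with p h1 h2 h3 h4
      have h5 : 0 ≤ p.1 * p.2 := mul_nonneg (by linarith) h4
      have h6 : ⌊p.1 * p.2 + 0⌋ = 0 := Int.floor_eq_iff.mpr (by simpa using ⟨h5, h2⟩)
      have h7 : Tab 0 p.1 p.2 = p.1 * p.2 := by rw [Tab_eq, h6]; simp
      simp only [cd, h6, h7, h1 h5]
  · exact ⟨_, (cont_claim κ 0 h0).mono fun p hp _ => hp⟩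

lemma main_local {α β0 : ℝ} (hg : Gen α β0) (κ : ℕ) : ∀ y0 : ℝ,
    ∃ w1 w2, ∀ᶠ p : ℝ × ℝ in 𝓝 (β0, y0), cd α κ p.1 p.2 = w1 ∨ cd α κ p.1 p.2 = w2 := by
  induction κ with
  | zero => intro y0; exact ⟨[], [], by simp [cd]⟩
  | succ κ ih =>
    intro y0
    by_cases h0 : Tab α β0 y0 = 0
    · obtain ⟨wz, hz⟩ := zero_side hg κ
      have ho := cont_claim κ 1 hg.2.1
      set m := ⌊β0 * y0 + α⌋ with hm
      have hm' : β0 * y0 + α = m := by rw [Tab_eq] at h0; linarith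
      refine ⟨m :: wz, (m-1) :: cd α κ β0 1, ?_⟩
      have hc1 : Tendsto (fun p : ℝ × ℝ => (p.1, p.1 * p.2 + α - m)) (𝓝 (β0, y0)) (𝓝 (β0, 0)) :=
        Continuous.tendsto' (by fun_prop) _ _ (by simp [hm'])
      have hc2 : Tendsto (fun p : ℝ × ℝ => (p.1, p.1 * p.2 + α - m + 1)) (𝓝 (β0, y0))
        (𝓝 (β0, 1)) := Continuous.tendsto' (by fun_prop) _ _ (by simp [hm'])
      have hc3 : Tendsto (fun p : ℝ × ℝ => p.1 * p.2 + α) (𝓝 (β0, y0)) (𝓝 m) :=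
        Continuous.tendsto' (by fun_prop) _ _ (by simp [hm'])
      filter_upwards [hc1.eventually hz, hc2.eventually ho,
        hc3.eventually (lt_mem_nhds (sub_one_lt (m:ℝ))),
        hc3.eventually (gt_mem_nhds (lt_add_one (m:ℝ)))] with p h1 h2 h3 h4
      by_cases h5 : (m:ℝ) ≤ p.1 * p.2 + α
      · left
        have h6 : ⌊p.1 * p.2 + α⌋ = m := Int.floor_eq_iff.mpr ⟨h5, h4⟩
        simp only [cd, Tab_eq, h6]
        rw [h1 (by simpa using h5)]
      · right
        have h6 : ⌊p.1 * p.2 + α⌋ = m - 1 := Int.floor_eq_iff.mpr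
          ⟨by push_cast; exact h3.le, by push_cast; linarith⟩
        simp only [cd, Tab_eq, h6]
        rw [← h2]
        simp only [Int.cast_sub, Int.cast_one]
        congr 2
        ring
    · obtain ⟨w1, w2, hw⟩ := ih (Tab α β0 y0)
      refine ⟨⌊β0 * y0 + α⌋ :: w1, ⌊β0 * y0 + α⌋ :: w2, ?_⟩
      filter_upwards [(tab_tendsto h0).eventually hw, floor_ev h0] with p h1 h2
      simp only [cd, h2]
      rcases h1 with h | h <;> simp [h]

lemma main_unif {α β0 : ℝ} (hg : Gen α β0) (κ : ℕ) : ∃ δ > 0, ∀ y0 ∈ Set.Icc (0:ℝ) 1,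
    ∃ w1 w2, ∀ β y, |β - β0| < δ → |y - y0| < δ → (cd α κ β y = w1 ∨ cd α κ β y = w2) := by
  have hK : IsCompact (Set.Icc (0:ℝ) 1) := isCompact_Icc
  refine hK.induction_on (p := fun s => ∃ δ > 0, ∀ y0 ∈ s,
    ∃ w1 w2, ∀ β y, |β - β0| < δ → |y - y0| < δ → (cd α κ β y = w1 ∨ cd α κ β y = w2))
    ⟨1, one_pos, by simp⟩ ?_ ?_ ?_
  · rintro s t hst ⟨δ, h1, h2⟩
    exact ⟨δ, h1, fun y hy => h2 y (hst hy)⟩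
  · rintro s t ⟨δ, h1, h2⟩ ⟨ε, h3, h4⟩
    refine ⟨min δ ε, lt_min h1 h3, ?_⟩
    rintro y0 (hy | hy)
    · obtain ⟨w1, w2, hw⟩ := h2 y0 hy
      exact ⟨w1, w2, fun β y ha hb => hw β y (lt_of_lt_of_le ha (min_le_left _ _))
        (lt_of_lt_of_le hb (min_le_left _ _))⟩
    · obtain ⟨w1, w2, hw⟩ := h4 y0 hy
      exact ⟨w1, w2, fun β y ha hb => hw β y (lt_of_lt_of_le ha (min_le_right _ _))
        (lt_of_lt_of_le hb (min_le_right _ _))⟩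
  · intro y0 _
    obtain ⟨w1, w2, hw⟩ := main_local hg κ y0
    rw [Metric.eventually_nhds_iff] at hw
    obtain ⟨ε, he, hw⟩ := hw
    refine ⟨Metric.ball y0 (ε/2), mem_nhdsWithin_of_mem_nhds (Metric.ball_mem_nhds _ (by linarith)),
      ε/2, by linarith, ?_⟩
    intro y1 hy1
    refine ⟨w1, w2, fun β y h1 h2 => @hw (β, y) ?_⟩
    rw [Metric.mem_ball] at hy1
    rw [Prod.dist_eq, max_lt_iff]
    rw [← Real.dist_eq] at h1 h2
    exact ⟨by linarith, by linarith [dist_triangle y y1 y0]⟩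

lemma cd_finite (α B : ℝ) (r : ℕ) : ∃ W : Finset (List ℤ), ∀ β ∈ Set.Icc (0:ℝ) B,
    ∀ y ∈ Set.Ico (0:ℝ) 1, cd α r β y ∈ W := by
  induction r with
  | zero => exact ⟨{[]}, by simp [cd]⟩
  | succ r ih =>
    obtain ⟨W, hW⟩ := ih
    refine ⟨(Finset.Icc ⌊α⌋ ⌊B+α⌋ ×ˢ W).image (fun p => p.1 :: p.2), ?_⟩
    intro β hβ y hy
    rw [Finset.mem_image]
    refine ⟨(⌊β*y+α⌋, cd α r β (Tab α β y)), ?_, rfl⟩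
    rw [Finset.mem_product, Finset.mem_Icc]
    refine ⟨⟨Int.floor_le_floor ?_, Int.floor_le_floor ?_⟩, hW β hβ _ ⟨Tab_nonneg _ _ _, Tab_lt _ _ _⟩⟩
    · have := mul_nonneg hβ.1 hy.1
      linarith
    · have : β * y ≤ B * 1 := mul_le_mul hβ.2 hy.2.le hy.1 (hβ.1.trans hβ.2)
      linarith

open scoped Topology

/-- standing local assumptions -/
structure Loc (α x b b1 δ : ℝ) (κ n : ℕ) (J : Set ℝ) (W : Finset (List ℤ)) : Prop where
  hx : x ∈ Set.Ico (0:ℝ) 1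
  hb1 : 1 < b1
  hb : b1 ≤ b
  hJ : ∀ β ∈ J, b ≤ β ∧ ∀ m ≤ n, β^m ≤ 3 * b^m
  hfin : volume J ≠ ⊤
  hδ : 0 < δ
  hloc : ∀ y0 ∈ Set.Icc (0:ℝ) 1, ∃ w1 w2, ∀ β ∈ J, ∀ y, |y - y0| < δ →
    (cd α κ β y = w1 ∨ cd α κ β y = w2)
  hW : ∀ β ∈ J, ∀ y ∈ Set.Ico (0:ℝ) 1, cd α κ β y ∈ W
  hbκ : 4 ≤ b^κ

lemma Loc.one_lt {α x b b1 δ : ℝ} {κ n : ℕ} {J : Set ℝ} {W : Finset (List ℤ)}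
    (L : Loc α x b b1 δ κ n J W) {β : ℝ} (hβ : β ∈ J) : 1 < β :=
  L.hb1.trans_le (L.hb.trans (L.hJ β hβ).1)

lemma Loc.ordConn {α x b b1 δ : ℝ} {κ n : ℕ} {J : Set ℝ} {W : Finset (List ℤ)}
    (L : Loc α x b b1 δ κ n J W) {S : Set ℝ} (hS : S ⊆ J) (hc : S.OrdConnected) (M : ℕ)
    (w : List ℤ) : {β ∈ S | cd α M β x = w}.OrdConnected := by
  refine ⟨fun β1 h1 β3 h3 β2 h2 => ⟨hc.out h1.1 h3.1 h2, ?_⟩⟩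
  rw [← h1.2]
  exact cd_ordConn (Set.Ico_subset_Icc_self L.hx) (L.one_lt (hS h1.1)) h2.1 h2.2
    (h1.2.trans h3.2.symm)

lemma sub_le_vol {S : Set ℝ} (hS : S.OrdConnected) (hf : volume S ≠ ⊤) {u v : ℝ} (hu : u ∈ S)
    (hv : v ∈ S) : v - u ≤ volume.real S := by
  rcases le_total u v with h | h
  · have := measureReal_mono (μ := volume) (hS.out hu hv) hf
    rwa [Real.volume_real_Icc_of_le h] at this
  · have : 0 ≤ volume.real S := measureReal_nonneg
    linarith

lemma Loc.split {α x b b1 δ : ℝ} {κ n : ℕ} {J : Set ℝ} {W : Finset (List ℤ)}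
    (L : Loc α x b b1 δ κ n J W) {S : Set ℝ} (hS : S ⊆ J) (hc : S.OrdConnected) {M : ℕ} (hM : M ≤ n)
    {w : List ℤ} (hw : ∀ β ∈ S, cd α M β x = w) :
    ∃ F : Finset (List ℤ), (∀ β ∈ S, cd α (M+κ) β x ∈ F) ∧
      (F.card : ℝ) ≤ 2 + 3 * W.card / (δ * (b1-1)) * volume.real S * b^M := by
  have hfS : volume S ≠ ⊤ := measure_ne_top_of_subset hS L.hfin
  have hb1 := L.hb1
  have hδ := L.hδ
  have hb := L.hb
  have hb0 : 0 < b := by linarith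
  have hb10 : 0 < b1 - 1 := by linarith
  have hvol : 0 ≤ volume.real S := measureReal_nonneg
  by_cases hs : ∀ β ∈ S, ∀ β' ∈ S, (Tab α β')^[M] x - (Tab α β)^[M] x < δ
  · rcases S.eq_empty_or_nonempty with he | ⟨β0, hβ0⟩
    · refine ⟨∅, by simp [he], ?_⟩
      simp only [Finset.card_empty, Nat.cast_zero]
      positivity
    · obtain ⟨w1, w2, h12⟩ := L.hloc _ (iter_mem_Icc α β0 (Set.Ico_subset_Icc_self L.hx) M)
      refine ⟨{w ++ w1, w ++ w2}, ?_, ?_⟩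
      · intro β hβ
        rw [cd_add, hw β hβ]
        have := h12 β (hS hβ) ((Tab α β)^[M] x) (by
          rw [abs_lt]
          constructor
          · linarith [hs β hβ β0 hβ0]
          · linarith [hs β0 hβ0 β hβ])
        rcases this with h | h <;> simp [h]
      · have : (({w ++ w1, w ++ w2} : Finset (List ℤ)).card : ℝ) ≤ 2 := by
          exact_mod_cast Finset.card_le_two
        have : 0 ≤ 3 * W.card / (δ * (b1-1)) * volume.real S * b^M := by positivity
        linarith
  · push Not at hs
    obtain ⟨β, hβ, β', hβ', hd⟩ := hs
    have hlt : β ≤ β' := by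
      by_contra hcon
      push Not at hcon
      have := (diff_bounds (Set.Ico_subset_Icc_self L.hx) (L.one_lt (hS hβ')) hcon.le
        ((hw _ hβ').trans (hw _ hβ).symm)).1
      linarith
    have h1 := (diff_bounds (Set.Ico_subset_Icc_self L.hx) (L.one_lt (hS hβ)) hlt
        ((hw _ hβ).trans (hw _ hβ').symm)).2
    have h2 := sub_le_vol hc hfS hβ hβ'
    have h3 := (L.hJ β (hS hβ)).2 M hM
    have h4 := (L.hJ β (hS hβ)).1
    have h5 : δ * (b1 - 1) ≤ volume.real S * (3 * b^M) := by
      calc δ * (b1 - 1) ≤ ((Tab α β')^[M] x - (Tab α β)^[M] x) * (β - 1) := by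
            apply mul_le_mul hd (by linarith) hb10.le (by linarith)
        _ ≤ (β' - β) * (β^M - 1) := h1
        _ ≤ (β' - β) * (β^M) := by
            apply mul_le_mul_of_nonneg_left (by linarith) (by linarith)
        _ ≤ volume.real S * (3 * b^M) := by
            apply mul_le_mul h2 h3 (by have := L.one_lt (hS hβ); positivity) hvol
    refine ⟨W.image (w ++ ·), ?_, ?_⟩
    · intro β hβ
      rw [cd_add, hw β hβ]
      exact Finset.mem_image_of_mem _ (L.hW β (hS hβ) _ (iter_mem_Ico α β L.hx M))
    · have h6 : ((W.image (w ++ ·)).card : ℝ) ≤ W.card := by exact_mod_cast Finset.card_image_le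
      have h7 : (W.card : ℝ) ≤ 3 * W.card / (δ * (b1-1)) * volume.real S * b^M := by
        have : 3 * W.card / (δ * (b1-1)) * volume.real S * b^M =
          W.card * (volume.real S * (3 * b^M)) / (δ * (b1-1)) := by ring
        rw [this, le_div_iff₀ (by positivity)]
        gcongr
      linarith

lemma sum_vol_le {S : Set ℝ} (hf : volume S ≠ ⊤) (V : Finset (List ℤ)) (f : ℝ → List ℤ)
    (hm : ∀ w, MeasurableSet {β ∈ S | f β = w}) :
    ∑ w ∈ V, volume.real {β ∈ S | f β = w} ≤ volume.real S := by
  rw [← measureReal_biUnion_finset (h := fun w _ =>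
    measure_ne_top_of_subset (Set.sep_subset _ _) hf)]
  · apply measureReal_mono _ hf
    intro β
    simp only [Set.mem_iUnion]
    rintro ⟨w, _, h, _⟩
    exact h
  · intro w _ w' _ hne
    refine Set.disjoint_left.mpr ?_
    rintro β ⟨_, h1⟩ ⟨_, h2⟩
    exact hne (h1.symm.trans h2)
  · intro w _
    exact hm w

lemma Loc.count {α x b b1 δ : ℝ} {κ n : ℕ} {J : Set ℝ} {W : Finset (List ℤ)}
    (L : Loc α x b b1 δ κ n J W) {S : Set ℝ} (hS : S ⊆ J) (hc : S.OrdConnected) {m : ℕ}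
    {w0 : List ℤ} (hw0 : ∀ β ∈ S, cd α m β x = w0) (i : ℕ) (hi : m + i * κ ≤ n) :
    ∃ V : Finset (List ℤ), (∀ β ∈ S, cd α (m+i*κ) β x ∈ V) ∧
      (V.card : ℝ) ≤ 2^i + 3 * W.card / (δ * (b1-1)) * volume.real S * b^(m+i*κ) := by
  classical
  have hfS : volume S ≠ ⊤ := measure_ne_top_of_subset hS L.hfin
  have hb1 := L.hb1
  have hδ := L.hδ
  have hb := L.hb
  have hb0 : 0 < b := by linarith
  have hb10 : 0 < b1 - 1 := by linarith
  have hvol : 0 ≤ volume.real S := measureReal_nonneg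
  set C := 3 * W.card / (δ * (b1-1)) with hC
  have hC0 : 0 ≤ C := by positivity
  induction i with
  | zero =>
    refine ⟨{w0}, by simpa using hw0, ?_⟩
    simp only [Finset.card_singleton, Nat.cast_one, pow_zero]
    have : 0 ≤ C * volume.real S * b ^ (m + 0 * κ) := by positivity
    linarith
  | succ i ih =>
    have hi' : m + i * κ ≤ n := by
      have : (i+1) * κ = i * κ + κ := by ring
      omega
    obtain ⟨V, hV, hVc⟩ := ih hi'
    set M := m + i * κ with hM
    have hMs : m + (i+1) * κ = M + κ := by rw [hM]; ring
    rw [hMs]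
    have hex : ∀ w, ∃ F : Finset (List ℤ), (∀ β ∈ {β ∈ S | cd α M β x = w}, cd α (M+κ) β x ∈ F) ∧
      (F.card : ℝ) ≤ 2 + C * volume.real {β ∈ S | cd α M β x = w} * b^M := fun w =>
        L.split ((Set.sep_subset _ _).trans hS) (L.ordConn hS hc M w) hi' (fun β hβ => hβ.2)
    choose F hF1 hF2 using hex
    refine ⟨V.biUnion F, ?_, ?_⟩
    · intro β hβ
      rw [Finset.mem_biUnion]
      exact ⟨_, hV β hβ, hF1 _ β ⟨hβ, rfl⟩⟩
    · have h1 : ((V.biUnion F).card : ℝ) ≤ ∑ w ∈ V, ((F w).card : ℝ) := by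
        exact_mod_cast Finset.card_biUnion_le
      have h2 : ∑ w ∈ V, ((F w).card : ℝ) ≤
          ∑ w ∈ V, (2 + C * volume.real {β ∈ S | cd α M β x = w} * b^M) :=
        Finset.sum_le_sum fun w _ => hF2 w
      rw [Finset.sum_add_distrib, ← Finset.sum_mul, ← Finset.mul_sum] at h2
      have h3 := sum_vol_le hfS V (fun β => cd α M β x)
        (fun w => (L.ordConn hS hc M w).measurableSet)
      have h4 : C * (∑ w ∈ V, volume.real {β ∈ S | cd α M β x = w}) * b^M ≤
          C * volume.real S * b^M := by gcongr
      have h5 : 3 * (C * volume.real S * b^M) ≤ C * volume.real S * b^(M+κ) := by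
        have : 0 ≤ C * volume.real S * b^M := by positivity
        rw [pow_add b M κ, ← mul_assoc]
        nlinarith [L.hbκ]
      simp only [Finset.sum_const, nsmul_eq_mul] at h2
      rw [pow_succ]
      linarith

open scoped Topology ENNReal

/-- visit indicator -/
noncomputable def Vis (α x a a' : ℝ) (t : ℕ) (β : ℝ) : ℝ≥0∞ :=
  {β | (Tab α β)^[t] x ∈ Set.Ico a a'}.indicator 1 β

lemma measurable_iter (α x : ℝ) (t : ℕ) : Measurable fun β : ℝ => (Tab α β)^[t] x := by
  induction t with
  | zero => simp
  | succ t ih =>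
    simp only [Function.iterate_succ_apply']
    unfold Tab
    exact measurable_fract.comp ((measurable_id.mul ih).add_const _)

lemma measurableSet_vis (α x a a' : ℝ) (t : ℕ) :
    MeasurableSet {β | (Tab α β)^[t] x ∈ Set.Ico a a'} := measurable_iter α x t measurableSet_Ico

lemma measurable_Vis (α x a a' : ℝ) (t : ℕ) : Measurable (Vis α x a a' t) :=
  measurable_one.indicator (measurableSet_vis α x a a' t)

lemma Loc.visit {α x b b1 δ : ℝ} {κ n : ℕ} {J : Set ℝ} {W : Finset (List ℤ)}
    (L : Loc α x b b1 δ κ n J W) {S : Set ℝ} (hS : S ⊆ J) (hc : S.OrdConnected) {M : ℕ} (hM : 2 ≤ M)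
    {w : List ℤ} (hw : ∀ β ∈ S, cd α M β x = w) {a a' c B : ℝ} (haa : a < a')
    (hcpos : 0 < c) (hcc : c ≤ x ∨ (x = 0 ∧ α ∈ Set.Ico (0:ℝ) 1 ∧ c ≤ α)) (hB : b ≤ B) :
    {β ∈ S | (Tab α β)^[M] x ∈ Set.Ico a a'}.OrdConnected ∧
    volume.real {β ∈ S | (Tab α β)^[M] x ∈ Set.Ico a a'} ≤ B^2 / c * (a' - a) / b^M := by
  have hx := Set.Ico_subset_Icc_self L.hx
  have hb0 : 1 < b := L.hb1.trans_le L.hb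
  obtain ⟨M, rfl⟩ := Nat.exists_eq_add_of_le' hM
  constructor
  · refine ⟨fun β1 h1 β3 h3 β2 h2 => ?_⟩
    have h2S := hc.out h1.1 h3.1 h2
    have e1 := (diff_bounds hx (L.one_lt (hS h1.1)) h2.1 ((hw _ h1.1).trans (hw _ h2S).symm)).1
    have e2 := (diff_bounds hx (L.one_lt (hS h2S)) h2.2 ((hw _ h2S).trans (hw _ h3.1).symm)).1
    have := h1.2.1
    have := h3.2.2
    exact ⟨h2S, by linarith, by linarith⟩
  · have hBc : 0 ≤ B^2 / c * (a' - a) / b^(M+2) := by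
      have : 0 < a' - a := by linarith
      positivity
    refine ENNReal.toReal_le_of_le_ofReal hBc ?_
    refine (Real.volume_le_diam _).trans ?_
    refine Metric.ediam_le ?_
    have key : ∀ u v, u ∈ {β ∈ S | (Tab α β)^[M+2] x ∈ Set.Ico a a'} →
      v ∈ {β ∈ S | (Tab α β)^[M+2] x ∈ Set.Ico a a'} → u ≤ v →
      edist u v ≤ ENNReal.ofReal (B^2 / c * (a' - a) / b^(M+2)) := by
      intro u v hu hv huv
      rw [edist_comm, edist_dist, Real.dist_eq, abs_of_nonneg (by linarith)]
      apply ENNReal.ofReal_le_ofReal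
      have h1 := diff_lower hx (L.one_lt (hS hu.1)) huv hcc ((hw _ hu.1).trans (hw _ hv.1).symm)
      have h2 := hu.2.1
      have h3 := hv.2.2
      have h4 := (L.hJ u (hS hu.1)).1
      have h5 : c * (v - u) * b^M ≤ a' - a := by
        have : c * (v - u) * b^M ≤ c * (v - u) * u^M := by
          have : 0 ≤ v - u := by linarith
          gcongr
        linarith
      rw [le_div_iff₀ (by positivity), div_mul_eq_mul_div, le_div_iff₀ hcpos]
      calc (v - u) * b^(M+2) * c = b^2 * (c * (v - u) * b^M) := by ring
        _ ≤ B^2 * (a' - a) := by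
          have : 0 ≤ v - u := by linarith
          gcongr
    intro u hu v hv
    rcases le_total u v with h | h
    · exact key u v hu hv h
    · rw [edist_comm]; exact key v u hv hu h

lemma Loc.expMoment {α x b b1 δ : ℝ} {κ n : ℕ} {J : Set ℝ} {W : Finset (List ℤ)}
    (L : Loc α x b b1 δ κ n J W) {a a' c B : ℝ} (haa : a < a')
    (hcpos : 0 < c) (hcc : c ≤ x ∨ (x = 0 ∧ α ∈ Set.Ico (0:ℝ) 1 ∧ c ≤ α)) (hB : b ≤ B)
    {t : ℕ} (ht : (1/2:ℝ)^t ≤ a' - a) (hk : 2 ≤ t * κ) {D : ℝ}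
    (hD : D = (B^2/c + 1) * (3 * W.card / (δ * (b1-1)) + 1))
    (q : ℕ) : ∀ (m i : ℕ) (S : Set ℝ) (w : List ℤ), 1 ≤ i → m + (i + q) * (t*κ) ≤ n → S ⊆ J →
      S.OrdConnected → (∀ β ∈ S, cd α m β x = w) →
      ∫⁻ β in S, ∏ j ∈ Finset.range q, (1 + Vis α x a a' (m + (i+j)*(t*κ)) β) ≤
      ENNReal.ofReal ((1 + D * (a'-a))^q * (volume.real S + (a' - a)/b^m)) := by
  have hb0 : 1 < b := L.hb1.trans_le L.hb
  have hθ : 0 < a' - a := by linarith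
  have hb10 : 0 < b1 - 1 := by linarith [L.hb1]
  have hδ := L.hδ
  set C := 3 * W.card / (δ * (b1-1)) with hC
  have hC0 : 0 ≤ C := by positivity
  have hB0 : 0 < B := by linarith
  have hD0 : 0 ≤ D := by rw [hD]; positivity
  induction q with
  | zero =>
    intro m i S w hi hn hS hc hw
    have hfS : volume S ≠ ⊤ := measure_ne_top_of_subset hS L.hfin
    simp only [Finset.range_zero, Finset.prod_empty, lintegral_const, one_mul, pow_zero,
      Measure.restrict_apply_univ]
    rw [← ENNReal.ofReal_toReal hfS]
    apply ENNReal.ofReal_le_ofReal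
    have : 0 < (a' - a)/b^m := by positivity
    change volume.real S ≤ _
    linarith
  | succ q ih =>
    intro m i S w hi hn hS hc hw
    have hfS : volume S ≠ ⊤ := measure_ne_top_of_subset hS L.hfin
    have hvol : 0 ≤ volume.real S := measureReal_nonneg
    set M := m + i * (t*κ) with hM
    have hMn : M + (1 + q) * (t*κ) ≤ n := by
      have : m + (i + (q+1)) * (t*κ) = M + (1 + q) * (t*κ) := by rw [hM]; ring
      omega
    set H : ℝ → ℝ≥0∞ := fun β => ∏ j ∈ Finset.range q, (1 + Vis α x a a' (m + ((i+1)+j)*(t*κ)) β)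
      with hH
    have hHm : Measurable H := by
      refine Finset.measurable_prod _ fun j _ => ?_
      exact (measurable_Vis _ _ _ _ _).const_add 1
    have hHM : H = fun β => ∏ j ∈ Finset.range q, (1 + Vis α x a a' (M + (1+j)*(t*κ)) β) := by
      funext β
      refine Finset.prod_congr rfl fun j _ => ?_
      congr 2
      rw [hM]; ring
    have e0 : ∀ β, ∏ j ∈ Finset.range (q+1), (1 + Vis α x a a' (m + (i+j)*(t*κ)) β) =
        H β + {β | (Tab α β)^[M] x ∈ Set.Ico a a'}.indicator H β := by
      intro β
      rw [Finset.prod_range_succ']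
      have : (∏ j ∈ Finset.range q, (1 + Vis α x a a' (m + (i+(j+1))*(t*κ)) β)) = H β :=
        Finset.prod_congr rfl (fun j _ => by rw [show i+(j+1)=i+1+j by ring])
      rw [this, add_zero, mul_add, mul_one]
      congr 1
      change H β * Vis α x a a' M β = _
      unfold Vis
      by_cases h : β ∈ {β | (Tab α β)^[M] x ∈ Set.Ico a a'}
      · rw [Set.indicator_of_mem h, Set.indicator_of_mem h]; simp
      · rw [Set.indicator_of_notMem h, Set.indicator_of_notMem h]; simp
    simp only [e0]
    rw [lintegral_add_left hHm]
    have e1 : ∫⁻ β in S, H β ≤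
        ENNReal.ofReal ((1 + D * (a'-a))^q * (volume.real S + (a' - a)/b^m)) := by
      refine ih m (i+1) S w (by omega) ?_ hS hc hw
      have : i + 1 + q = i + (q+1) := by ring
      rw [this]; exact hn
    have hitκ : i * (t * κ) = i * t * κ := by ring
    obtain ⟨V, hV, hVc⟩ := L.count hS hc hw (i*t) (by rw [← hitκ]; omega)
    rw [← hitκ, ← hM] at hVc
    rw [← hitκ] at hV
    have hM2 : 2 ≤ M := by
      have : 1 * (t*κ) ≤ i * (t*κ) := Nat.mul_le_mul_right _ hi
      omega
    have e2 : ∫⁻ β in S, {β | (Tab α β)^[M] x ∈ Set.Ico a a'}.indicator H β ≤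
        ∑ w ∈ V, ∫⁻ β in {β ∈ {β ∈ S | cd α M β x = w} | (Tab α β)^[M] x ∈ Set.Ico a a'}, H β := by
      rw [lintegral_indicator (measurableSet_vis α x a a' M), Measure.restrict_restrict
        (measurableSet_vis α x a a' M)]
      refine le_trans ?_ (lintegral_biUnion_finset (μ := volume) ?_ ?_ H).le
      · apply lintegral_mono_set
        rintro β ⟨h1, h2⟩
        simp only [Set.mem_iUnion]
        exact ⟨_, hV β h2, ⟨h2, rfl⟩, h1⟩
      · intro w _ w' _ hne
        refine Set.disjoint_left.mpr ?_
        rintro β ⟨⟨_, h1⟩, _⟩ ⟨⟨_, h2⟩, _⟩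
        exact hne (h1.symm.trans h2)
      · intro w _
        exact ((L.ordConn hS hc M w).measurableSet).inter (measurableSet_vis α x a a' M)
    have e3 : ∀ w ∈ V,
        ∫⁻ β in {β ∈ {β ∈ S | cd α M β x = w} | (Tab α β)^[M] x ∈ Set.Ico a a'}, H β ≤
        ENNReal.ofReal ((1 + D * (a'-a))^q * ((B^2/c + 1) * (a' - a) / b^M)) := by
      intro w _
      obtain ⟨v1, v2⟩ := L.visit (S := {β ∈ S | cd α M β x = w}) ((Set.sep_subset _ _).trans hS)
        (L.ordConn hS hc M w) hM2 (fun β hβ => hβ.2) haa hcpos hcc hB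
      have := ih M 1 _ w le_rfl hMn
        ((Set.sep_subset _ _).trans ((Set.sep_subset _ _).trans hS)) v1 (fun β hβ => hβ.1.2)
      rw [hHM]
      refine this.trans (ENNReal.ofReal_le_ofReal ?_)
      have hp : 0 ≤ (1 + D * (a'-a))^q := by positivity
      apply mul_le_mul_of_nonneg_left _ hp
      calc _ ≤ B^2 / c * (a' - a) / b^M + (a' - a) / b^M := by linarith
        _ = _ := by ring
    have e4 : ∫⁻ β in S, {β | (Tab α β)^[M] x ∈ Set.Ico a a'}.indicator H β ≤
        ENNReal.ofReal (V.card * ((1 + D * (a'-a))^q * ((B^2/c + 1) * (a' - a) / b^M))) := by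
      refine e2.trans ((Finset.sum_le_sum e3).trans ?_)
      rw [Finset.sum_const, nsmul_eq_mul, ENNReal.ofReal_mul (p := (V.card:ℝ)) (by positivity),
        ENNReal.ofReal_natCast]
    refine (add_le_add e1 e4).trans ?_
    rw [← ENNReal.ofReal_add (by positivity) (by positivity)]
    apply ENNReal.ofReal_le_ofReal
    have hbm : 0 < b^m := by positivity
    have hbM : 0 < b^M := by positivity
    have g1 : (2:ℝ)^(i*t) / b^M ≤ (a' - a) / b^m := by
      rw [div_le_div_iff₀ hbM hbm]
      have : (2:ℝ)^(i*t) ≤ (a' - a) * b^(i*(t*κ)) := by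
        have h4 : (4:ℝ)^(i*t) ≤ b^(i*(t*κ)) := by
          rw [hitκ, mul_comm (i*t) κ, pow_mul b]
          exact pow_le_pow_left₀ (by norm_num) L.hbκ _
        have h5 : (1/2:ℝ)^(i*t) ≤ a' - a := by
          refine le_trans ?_ ht
          apply pow_le_pow_of_le_one (by norm_num) (by norm_num)
          nlinarith
        calc (2:ℝ)^(i*t) = (1/2)^(i*t) * 4^(i*t) := by rw [← mul_pow]; norm_num
          _ ≤ _ := by gcongr
      calc (2:ℝ)^(i*t) * b^m ≤ ((a' - a) * b^(i*(t*κ))) * b^m := by gcongr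
        _ = (a' - a) * b^M := by rw [hM, pow_add]; ring
    have g2 : V.card * ((B^2/c + 1) * (a' - a) / b^M) ≤
        D * (a' - a) * (volume.real S + (a' - a)/b^m) := by
      calc V.card * ((B^2/c + 1) * (a' - a) / b^M)
          ≤ (2^(i*t) + C * volume.real S * b^M) * ((B^2/c + 1) * (a' - a) / b^M) := by gcongr
        _ = ((B^2/c + 1) * (a' - a)) * (2^(i*t) / b^M + C * volume.real S) := by
            field_simp
        _ ≤ ((B^2/c + 1) * (a' - a)) * ((C + 1) * (volume.real S + (a' - a)/b^m)) := by
            gcongr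
            have : 0 ≤ (a' - a)/b^m := by positivity
            nlinarith
        _ = _ := by rw [hD]; ring
    have hp : 0 ≤ (1 + D * (a'-a))^q := by positivity
    have := mul_le_mul_of_nonneg_left g2 hp
    rw [pow_succ (1 + D*(a'-a)) q]
    nlinarith

open scoped Topology ENNReal

open Classical in
/-- visit counter along an arithmetic progression -/
noncomputable def cnt (α x a a' : ℝ) (r k q : ℕ) (β : ℝ) : ℕ :=
  ((Finset.range q).filter (fun j => (Tab α β)^[r + (1+j)*k] x ∈ Set.Ico a a')).card

lemma prod_vis (α x a a' : ℝ) (r k q : ℕ) (β : ℝ) :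
    ∏ j ∈ Finset.range q, (1 + Vis α x a a' (r + (1+j)*k) β) = 2 ^ cnt α x a a' r k q β := by
  classical
  unfold cnt
  rw [Finset.card_filter, ← Finset.prod_pow_eq_pow_sum]
  refine Finset.prod_congr rfl fun j _ => ?_
  unfold Vis
  by_cases h : (Tab α β)^[r + (1+j)*k] x ∈ Set.Ico a a'
  · rw [Set.indicator_of_mem (by exact h)]; simp only [h, if_true]; simp; norm_num
  · rw [Set.indicator_of_notMem (by exact h)]; simp [h]

lemma cnt_le (α x a a' : ℝ) (r k q : ℕ) (β : ℝ) : cnt α x a a' r k q β ≤ q := by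
  unfold cnt
  exact (Finset.card_filter_le _ _).trans (by simp)

lemma Loc.markov {α x b b1 δ : ℝ} {κ n : ℕ} {J : Set ℝ} {W : Finset (List ℤ)}
    (L : Loc α x b b1 δ κ n J W) (hJc : J.OrdConnected) (hJ1 : volume.real J ≤ 1)
    {a a' c B : ℝ} (haa : a < a')
    (hcpos : 0 < c) (hcc : c ≤ x ∨ (x = 0 ∧ α ∈ Set.Ico (0:ℝ) 1 ∧ c ≤ α)) (hB : b ≤ B)
    {t : ℕ} (ht : (1/2:ℝ)^t ≤ a' - a) (hk : 2 ≤ t * κ) {D : ℝ}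
    (hD : D = (B^2/c + 1) * (3 * W.card / (δ * (b1-1)) + 1))
    (q r : ℕ) (Wr : Finset (List ℤ)) (hWr : ∀ β ∈ J, cd α r β x ∈ Wr)
    (hn : r + (1 + q) * (t*κ) ≤ n) :
    volume (J ∩ {β | 2 * D * (a'-a) * q ≤ cnt α x a a' r (t*κ) q β}) ≤
      ENNReal.ofReal (Wr.card * (1 + (a'-a)) * (Real.exp (D * (a'-a) * (1 - 2 * Real.log 2)))^q) := by
  have hb0 : 1 < b := L.hb1.trans_le L.hb
  have hθ : 0 < a' - a := by linarith
  have hb10 : 0 < b1 - 1 := by linarith [L.hb1]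
  have hδ := L.hδ
  have hD0 : 0 ≤ D := by rw [hD]; positivity
  set P : ℝ → ℝ≥0∞ := fun β => ∏ j ∈ Finset.range q, (1 + Vis α x a a' (r + (1+j)*(t*κ)) β) with hP
  have hPm : Measurable P := by
    refine Finset.measurable_prod _ fun j _ => ?_
    exact (measurable_Vis _ _ _ _ _).const_add 1
  have e1 : ∫⁻ β in J, P β ≤ ENNReal.ofReal (Wr.card * ((1 + D * (a'-a))^q * (1 + (a'-a)))) := by
    have : J = ⋃ w ∈ Wr, {β ∈ J | cd α r β x = w} := by
      ext β
      simp only [Set.mem_iUnion, Set.mem_ofPred_eq]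
      exact ⟨fun h => ⟨_, hWr β h, h, rfl⟩, fun ⟨_, _, h, _⟩ => h⟩
    rw [this, lintegral_biUnion_finset]
    all_goals clear this
    · rw [ENNReal.ofReal_mul (p := (Wr.card:ℝ)) (by positivity), ENNReal.ofReal_natCast, ← nsmul_eq_mul]
      refine Finset.sum_le_card_nsmul _ _ _ fun w _ => ?_
      refine (L.expMoment haa hcpos hcc hB ht hk hD q r 1 _ w le_rfl hn (Set.sep_subset _ _)
        (L.ordConn subset_rfl hJc r w) (fun β hβ => hβ.2)).trans (ENNReal.ofReal_le_ofReal ?_)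
      have h1 : volume.real {β ∈ J | cd α r β x = w} ≤ 1 :=
        (measureReal_mono (Set.sep_subset _ _) L.hfin).trans hJ1
      have h2 : (a' - a)/b^r ≤ a' - a := div_le_self hθ.le (one_le_pow₀ hb0.le)
      gcongr
    · intro w _ w' _ hne
      refine Set.disjoint_left.mpr ?_
      rintro β ⟨_, h1⟩ ⟨_, h2⟩
      exact hne (h1.symm.trans h2)
    · intro w _
      exact (L.ordConn subset_rfl hJc r w).measurableSet
  set E := Real.exp (D * (a'-a) * (2 * Real.log 2) * q) with hE
  have hE0 : 0 < E := Real.exp_pos _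
  have e2 : J ∩ {β | 2 * D * (a'-a) * q ≤ cnt α x a a' r (t*κ) q β} ⊆
      J ∩ {β | ENNReal.ofReal E ≤ P β} := by
    rintro β ⟨h1, h2⟩
    refine ⟨h1, ?_⟩
    change _ ≤ P β
    rw [hP]
    change _ ≤ ∏ j ∈ Finset.range q, (1 + Vis α x a a' (r + (1+j)*(t*κ)) β)
    rw [prod_vis, show (2:ℝ≥0∞) = ENNReal.ofReal 2 by simp, ← ENNReal.ofReal_pow (by norm_num)]
    apply ENNReal.ofReal_le_ofReal
    have : (2:ℝ)^(cnt α x a a' r (t*κ) q β) = Real.exp (Real.log 2 * cnt α x a a' r (t*κ) q β) := by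
      rw [mul_comm (Real.log 2), Real.exp_nat_mul, Real.exp_log (by norm_num)]
    rw [this, hE]
    apply Real.exp_le_exp.mpr
    have h3 : 0 < Real.log 2 := Real.log_pos (by norm_num)
    have h2' : 2 * D * (a'-a) * q ≤ cnt α x a a' r (t*κ) q β := h2
    nlinarith
  have e3 := mul_meas_ge_le_lintegral (μ := volume.restrict J) hPm (ENNReal.ofReal E)
  rw [Measure.restrict_apply (measurableSet_le measurable_const hPm), Set.inter_comm] at e3
  have e4 := e3.trans e1
  refine (measure_mono e2).trans ?_
  have hE1 : ENNReal.ofReal E ≠ 0 := by simpa using hE0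
  rw [mul_comm, ← ENNReal.le_div_iff_mul_le (Or.inl hE1) (Or.inl ENNReal.ofReal_ne_top),
    ← ENNReal.ofReal_div_of_pos hE0] at e4
  refine e4.trans (ENNReal.ofReal_le_ofReal ?_)
  rw [div_le_iff₀ hE0]
  have h5 : (1 + D * (a'-a))^q ≤ Real.exp (D * (a'-a))^q := by
    gcongr
    linarith [Real.add_one_le_exp (D * (a'-a))]
  have h6 : Real.exp (D * (a'-a))^q = (Real.exp (D * (a'-a) * (1 - 2 * Real.log 2)))^q * E := by
    rw [hE, ← Real.exp_nat_mul, ← Real.exp_nat_mul, ← Real.exp_add]; congr 1; ring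
  calc Wr.card * ((1 + D * (a'-a))^q * (1 + (a'-a)))
      ≤ Wr.card * (Real.exp (D * (a'-a))^q * (1 + (a'-a))) := by gcongr
    _ = _ := by rw [h6]; ring

/-- deterministic combination -/
lemma count_combine {P : ℕ → Prop} [DecidablePred P] {k : ℕ} (hk : 0 < k) {C : ℝ} (hC : 0 ≤ C)
    (h : ∀ r < k, ∃ Q : ℕ, ∀ q ≥ Q,
      (((Finset.range q).filter (fun j => P (r + (1+j)*k))).card : ℝ) ≤ C * q) :
    ∃ K : ℝ, ∀ n : ℕ, (((Finset.range n).filter P).card : ℝ) ≤ C * n + K := by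
  choose! Q hQ using h
  refine ⟨k + ∑ r ∈ Finset.range k, (Q r : ℝ), fun n => ?_⟩
  have h1 : (Finset.range n).filter P ⊆ Finset.range k ∪ (Finset.range k).biUnion (fun r =>
      ((Finset.range (n/k)).filter (fun j => P (r + (1+j)*k))).image (fun j => r + (1+j)*k)) := by
    intro m hm
    rw [Finset.mem_filter, Finset.mem_range] at hm
    rw [Finset.mem_union]
    by_cases hmk : m < k
    · left; exact Finset.mem_range.mpr hmk
    · right
      rw [Finset.mem_biUnion]
      have h0 : 1 ≤ m / k := (Nat.one_le_div_iff hk).mpr (by omega)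
      have h2 : m / k ≤ n / k := Nat.div_le_div_right hm.1.le
      have h3 : m % k + (1 + (m/k - 1)) * k = m := by
        rw [show 1 + (m/k - 1) = m/k by omega, mul_comm]; exact Nat.mod_add_div m k
      refine ⟨m % k, Finset.mem_range.mpr (Nat.mod_lt _ hk), ?_⟩
      rw [Finset.mem_image]
      refine ⟨m/k - 1, ?_, h3⟩
      rw [Finset.mem_filter, Finset.mem_range, h3]
      exact ⟨by omega, hm.2⟩
  have h2 := (Finset.card_le_card h1).trans (Finset.card_union_le _ _)
  have h3 : (((Finset.range n).filter P).card : ℝ) ≤ k + ∑ r ∈ Finset.range k,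
      (((Finset.range (n/k)).filter (fun j => P (r + (1+j)*k))).card : ℝ) := by
    have : ((Finset.range n).filter P).card ≤ k + ∑ r ∈ Finset.range k,
      ((Finset.range (n/k)).filter (fun j => P (r + (1+j)*k))).card := by
      refine h2.trans ?_
      rw [Finset.card_range]
      exact Nat.add_le_add_left (Finset.card_biUnion_le.trans
        (Finset.sum_le_sum fun r _ => Finset.card_image_le)) _
    exact_mod_cast this
  clear h2
  refine h3.trans ?_
  have h4 : ∀ r ∈ Finset.range k,
      (((Finset.range (n/k)).filter (fun j => P (r + (1+j)*k))).card : ℝ) ≤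
        C * (n/k : ℕ) + Q r := by
    intro r hr
    rw [Finset.mem_range] at hr
    by_cases hq : Q r ≤ n/k
    · have := hQ r hr _ hq
      have h0 : (0:ℝ) ≤ Q r := by positivity
      linarith
    · have : ((Finset.range (n/k)).filter (fun j => P (r + (1+j)*k))).card ≤ n/k :=
        (Finset.card_filter_le _ _).trans (by simp)
      have h5 : ((Finset.range (n/k)).filter (fun j => P (r + (1+j)*k))).card ≤ Q r := by omega
      have h6 : (((Finset.range (n/k)).filter (fun j => P (r + (1+j)*k))).card : ℝ) ≤ Q r := by
        exact_mod_cast h5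
      have : 0 ≤ C * (n/k : ℕ) := by positivity
      linarith
  have h5 := Finset.sum_le_sum h4
  rw [Finset.sum_add_distrib, Finset.sum_const, Finset.card_range, nsmul_eq_mul] at h5
  have h6 : (k:ℝ) * (C * (n/k : ℕ)) ≤ C * n := by
    have : (k:ℝ) * (n/k : ℕ) ≤ n := by exact_mod_cast Nat.mul_div_le n k
    nlinarith
  linarith

open scoped Topology ENNReal

lemma pow_le_three {b β : ℝ} {n m : ℕ} (hb : 1 ≤ b) (hn : 0 < n) (hβ0 : b ≤ β) (hβ : β ≤ b + 1/n) (hm : m ≤ n) :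
    β^m ≤ 3 * b^m := by
  have hn' : (0:ℝ) < n := by exact_mod_cast hn
  have h1 : β ≤ b * Real.exp (1/n) := by
    have h2 := Real.add_one_le_exp (1/(n:ℝ))
    have h3 : 0 < 1/(n:ℝ) := by positivity
    nlinarith
  have hβ1 : 0 ≤ β := by linarith
  calc β^m ≤ (b * Real.exp (1/n))^m := by gcongr
    _ = b^m * Real.exp (m * (1/n)) := by rw [mul_pow, ← Real.exp_nat_mul]
    _ ≤ b^m * 3 := by
      gcongr
      have : (m:ℝ) * (1/n) ≤ 1 := by
        rw [mul_one_div, div_le_one hn']; exact_mod_cast hm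
      calc Real.exp (m * (1/n)) ≤ Real.exp 1 := Real.exp_le_exp.mpr this
        _ ≤ 3 := by linarith [Real.exp_one_lt_d9]
    _ = _ := by ring

lemma cover_pieces {u v : ℝ} (huv : u < v) {n : ℕ} (hn : 0 < n) :
    Set.Ico u v ⊆ ⋃ l ∈ Finset.range n, Set.Ico (u + l * ((v-u)/n)) (u + l * ((v-u)/n) + (v-u)/n) := by
  intro β hβ
  have hn' : (0:ℝ) < n := by exact_mod_cast hn
  have hd : 0 < (v-u)/n := by have := sub_pos.mpr huv; positivity
  have h0 : 0 ≤ (β-u)/((v-u)/n) := div_nonneg (by linarith [hβ.1]) hd.le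
  have h1 := Nat.floor_le h0
  have h2 := Nat.lt_floor_add_one ((β-u)/((v-u)/n))
  rw [le_div_iff₀ hd] at h1
  rw [div_lt_iff₀ hd] at h2
  simp only [Set.mem_iUnion]
  refine ⟨⌊(β-u)/((v-u)/n)⌋₊, ?_, ?_, ?_⟩
  · rw [Finset.mem_range, Nat.floor_lt h0, div_lt_iff₀ hd]
    have : (n:ℝ) * ((v-u)/n) = v - u := by field_simp
    linarith [hβ.2]
  · linarith
  · linarith

/-- The visit bound -/
def Good (α β x : ℝ) : Prop := ∃ D : ℝ, 0 ≤ D ∧ ∀ a a' : ℚ, a < a' → ∃ K : ℝ, ∀ n : ℕ,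
  ∑ m ∈ Finset.range n, (Set.Ico (a:ℝ) a').indicator (1 : ℝ → ℝ) ((Tab α β)^[m] x) ≤ D * (a'-a) * n + K

lemma local_good {α x β0 c : ℝ} (hx : x ∈ Set.Ico (0:ℝ) 1) (hg : Gen α β0)
    (hcpos : 0 < c) (hcc : c ≤ x ∨ (x = 0 ∧ α ∈ Set.Ico (0:ℝ) 1 ∧ c ≤ α)) :
    ∃ U ∈ 𝓝 β0, ∀ᵐ β ∂(volume.restrict U), Good α β x := by
  classical
  have hβ0 := hg.1
  set b1 := (1+β0)/2 with hb1d
  have hb1 : 1 < b1 := by rw [hb1d]; linarith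
  obtain ⟨κ, hκ⟩ := pow_unbounded_of_one_lt 4 hb1
  have hκ0 : 1 ≤ κ := by
    rcases Nat.eq_zero_or_pos κ with h | h
    · rw [h] at hκ; norm_num at hκ
    · exact h
  obtain ⟨δ, hδ, hloc⟩ := main_unif hg κ
  set η := min (δ/2) (min ((β0-1)/2) (1/2)) with hη
  have hη0 : 0 < η := by rw [hη]; refine lt_min (by positivity) (lt_min (by linarith) (by norm_num))
  have hη1 : η ≤ δ/2 := min_le_left _ _
  have hη2 : η ≤ (β0-1)/2 := (min_le_right _ _).trans (min_le_left _ _)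
  have hη3 : η ≤ 1/2 := (min_le_right _ _).trans (min_le_right _ _)
  set u := β0 - η with hu
  set v := β0 + η with hv
  have huv : u < v := by linarith
  set B := β0 + 1 with hB
  obtain ⟨W, hW⟩ := cd_finite α B κ
  set D := (B^2/c + 1) * (3 * W.card / (δ * (b1-1)) + 1) with hD
  have hb10 : 0 < b1 - 1 := by linarith
  have hD0 : 0 < D := by rw [hD]; positivity
  refine ⟨Set.Ico u v, Ico_mem_nhds (by linarith) (by linarith), ?_⟩
  suffices H : ∀ a a' : ℚ, a < a' → ∀ᵐ β ∂(volume.restrict (Set.Ico u v)), ∃ K : ℝ, ∀ n : ℕ,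
      ∑ m ∈ Finset.range n, (Set.Ico (a:ℝ) a').indicator (1 : ℝ → ℝ) ((Tab α β)^[m] x) ≤
        (2 * D) * (a'-a) * n + K by
    have : ∀ᵐ β ∂(volume.restrict (Set.Ico u v)), ∀ p : {p : ℚ × ℚ // p.1 < p.2}, ∃ K : ℝ, ∀ n : ℕ,
      ∑ m ∈ Finset.range n, (Set.Ico (p.1.1:ℝ) p.1.2).indicator (1 : ℝ → ℝ) ((Tab α β)^[m] x) ≤
        (2 * D) * (p.1.2-p.1.1) * n + K := ae_all_iff.mpr fun p => H p.1.1 p.1.2 p.2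
    filter_upwards [this] with β hβ
    exact ⟨2 * D, by positivity, fun a a' haa => hβ ⟨(a, a'), haa⟩⟩
  intro a a' haa
  have haa' : (a:ℝ) < a' := by exact_mod_cast haa
  set θ : ℝ := a' - a with hθd
  have hθ : 0 < θ := by rw [hθd]; linarith
  obtain ⟨t0, ht0⟩ := exists_pow_lt_of_lt_one hθ (show (1/2:ℝ) < 1 by norm_num)
  set t := t0 + 2 with htd
  have ht : (1/2:ℝ)^t ≤ θ := (pow_le_pow_of_le_one (by norm_num) (by norm_num) (by omega)).trans ht0.le
  have hk : 2 ≤ t * κ := by nlinarith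
  set k := t * κ with hkd
  set ρ := Real.exp (D * θ * (1 - 2 * Real.log 2)) with hρ
  have hρ1 : ρ < 1 := by
    rw [hρ, Real.exp_lt_one_iff]
    have := Real.log_two_gt_d9
    have : 0 < D * θ := by positivity
    nlinarith
  have hρ0 : 0 < ρ := Real.exp_pos _
  -- main estimate
  have key : ∀ r < k, ∀ᵐ β ∂(volume.restrict (Set.Ico u v)), ∃ Q : ℕ, ∀ q ≥ Q,
      (cnt α x a a' r k q β : ℝ) ≤ 2 * D * θ * q := by
    intro r hr
    obtain ⟨Wr, hWr⟩ := cd_finite α B r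
    set bad : ℕ → Set ℝ := fun q => {β | 2 * D * θ * q ≤ cnt α x a a' r k q β} with hbad
    have est : ∀ q, volume.restrict (Set.Ico u v) (bad q) ≤
        ENNReal.ofReal ((k * (Wr.card * (1 + θ))) * (((q:ℝ) + 2) * ρ^q)) := by
      intro q
      set n := k * (q+2) with hn
      have hn0 : 0 < n := by positivity
      have hn' : (0:ℝ) < n := by exact_mod_cast hn0
      have hd : 0 < (v-u)/n := by have := sub_pos.mpr huv; positivity
      have hdn : (n:ℝ) * ((v-u)/n) = v - u := by field_simp
      rw [Measure.restrict_apply' measurableSet_Ico, Set.inter_comm]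
      have : Set.Ico u v ∩ bad q ⊆ ⋃ l ∈ Finset.range n,
          (Set.Ico (u + l * ((v-u)/n)) (u + l * ((v-u)/n) + (v-u)/n) ∩ bad q) := by
        rintro β ⟨h1, h2⟩
        have := cover_pieces huv hn0 h1
        simp only [Set.mem_iUnion] at this ⊢
        obtain ⟨l, hl, h3⟩ := this
        exact ⟨l, hl, h3, h2⟩
      refine (measure_mono this).trans ((measure_biUnion_finset_le _ _).trans ?_)
      have hpiece : ∀ l ∈ Finset.range n,
          volume (Set.Ico (u + l * ((v-u)/n)) (u + l * ((v-u)/n) + (v-u)/n) ∩ bad q) ≤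
          ENNReal.ofReal (Wr.card * (1 + θ) * ρ^q) := by
        intro l hl
        rw [Finset.mem_range] at hl
        have hl' : (l:ℝ) + 1 ≤ n := by exact_mod_cast hl
        have hl0 : (0:ℝ) ≤ l := by positivity
        set b := u + l * ((v-u)/n) with hb
        have hub : u ≤ b := by rw [hb]; nlinarith
        have hbv : b + (v-u)/n ≤ v := by
          have : ((l:ℝ)+1) * ((v-u)/n) ≤ n * ((v-u)/n) := by gcongr
          rw [hb]; linarith
        have hbU : ∀ β ∈ Set.Ico b (b + (v-u)/n), β ∈ Set.Ico u v := fun β h =>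
          ⟨hub.trans h.1, h.2.trans_le hbv⟩
        have hBm : ∀ β ∈ Set.Ico b (b + (v-u)/n), β ∈ Set.Icc 0 B := fun β h => by
          have := hbU β h
          exact ⟨by linarith [this.1], by linarith [this.2]⟩
        have hdd : (v-u)/n ≤ 1/n := by gcongr; linarith
        have hbb : b1 ≤ b := by linarith
        have L : Loc α x b b1 δ κ n (Set.Ico b (b + (v-u)/n)) W :=
          { hx := hx
            hb1 := hb1
            hb := hbb
            hJ := fun β h => ⟨h.1, fun m hm =>
              pow_le_three (by linarith) hn0 h.1 (by linarith [h.2]) hm⟩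
            hfin := by simp
            hδ := hδ
            hloc := by
              intro y0 hy0
              obtain ⟨w1, w2, h12⟩ := hloc y0 hy0
              refine ⟨w1, w2, fun β h y hy => h12 β y ?_ hy⟩
              have := hbU β h
              rw [abs_lt]
              exact ⟨by linarith [this.1], by linarith [this.2]⟩
            hW := fun β h y hy => hW β (hBm β h) y hy
            hbκ := hκ.le.trans (by gcongr) }
        refine L.markov Set.ordConnected_Ico ?_ haa' hcpos hcc (by linarith) ht hk hD q r Wr
          (fun β h => hWr β (hBm β h) x hx) ?_
        · rw [Real.volume_real_Ico_of_le (by linarith)]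
          have : (1:ℝ)/n ≤ 1 := by rw [div_le_one hn']; exact_mod_cast hn0
          linarith
        · rw [hn, ← hkd]
          have : k * (q+2) = k + (1+q) * k := by ring
          omega
      refine (Finset.sum_le_card_nsmul _ _ _ hpiece).trans ?_
      rw [Finset.card_range, nsmul_eq_mul, ← ENNReal.ofReal_natCast, ← ENNReal.ofReal_mul (by positivity)]
      apply ENNReal.ofReal_le_ofReal
      apply le_of_eq
      rw [hn]; push_cast; ring
    have hs : Summable fun q : ℕ => (k * (Wr.card * (1 + θ))) * (((q:ℝ) + 2) * ρ^q) := by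
      apply Summable.mul_left
      have h1 := summable_pow_mul_geometric_of_norm_lt_one 1 (r := ρ)
        (by rw [Real.norm_of_nonneg hρ0.le]; exact hρ1)
      have h2 := (summable_geometric_of_lt_one hρ0.le hρ1).mul_left 2
      refine (h1.add h2).congr fun q => ?_
      rw [pow_one]; ring
    have hfin : ∑' q, volume.restrict (Set.Ico u v) (bad q) ≠ ∞ := by
      refine ne_top_of_le_ne_top ?_ (ENNReal.tsum_le_tsum est)
      exact hs.tsum_ofReal_ne_top
    filter_upwards [ae_eventually_notMem hfin] with β hβ
    obtain ⟨Q, hQ⟩ := eventually_atTop.mp hβ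
    exact ⟨Q, fun q hq => (not_le.mp (hQ q hq)).le⟩
  have key' : ∀ᵐ β ∂(volume.restrict (Set.Ico u v)), ∀ r : Fin k, ∃ Q : ℕ, ∀ q ≥ Q,
      (cnt α x a a' r k q β : ℝ) ≤ 2 * D * θ * q := ae_all_iff.mpr fun r => key r r.2
  filter_upwards [key'] with β hβ
  obtain ⟨K, hK⟩ := count_combine (P := fun m => (Tab α β)^[m] x ∈ Set.Ico (a:ℝ) a') (k := k)
    (by omega) (C := 2 * D * θ) (by positivity) (fun r hr => by
      obtain ⟨Q, hQ⟩ := hβ ⟨r, hr⟩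
      refine ⟨Q, fun q hq => ?_⟩
      have := hQ q hq
      unfold cnt at this
      convert this)
  refine ⟨K, fun n => le_trans (le_of_eq ?_) (hK n)⟩
  rw [Finset.card_filter]
  push_cast
  refine Finset.sum_congr rfl fun m _ => ?_
  simp only [Set.indicator_apply, Pi.one_apply]

lemma ae_good {α x : ℝ} (hx : x ∈ Set.Ico (0:ℝ) 1) (hα : α ∈ Set.Ico (0 : ℝ) 1)
    (hxα : (x, α) ≠ (0, 0)) : volume {β : ℝ | 1 < β ∧ ¬ Good α β x} = 0 := by
  obtain ⟨c, hc, hcc⟩ : ∃ c > 0, c ≤ x ∨ (x = 0 ∧ α ∈ Set.Ico (0:ℝ) 1 ∧ c ≤ α) := by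
    rcases hx.1.eq_or_lt with h | h
    · rcases hα.1.eq_or_lt with h' | h'
      · exact absurd (by rw [← h, ← h']) hxα
      · exact ⟨α, h', Or.inr ⟨h.symm, hα, le_rfl⟩⟩
    · exact ⟨x, h, Or.inl le_rfl⟩
  have h1 : volume {β : ℝ | Gen α β ∧ ¬ Good α β x} = 0 := by
    refine measure_null_of_locally_null _ fun β0 hβ0 => ?_
    obtain ⟨U, hU, h⟩ := local_good hx hβ0.1 hc hcc
    obtain ⟨V, hVU, hVo, hβV⟩ := mem_nhds_iff.mp hU
    refine ⟨{β : ℝ | Gen α β ∧ ¬ Good α β x} ∩ V, ?_, ?_⟩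
    · exact inter_mem self_mem_nhdsWithin (mem_nhdsWithin_of_mem_nhds (hVo.mem_nhds hβV))
    · have := ae_restrict_of_ae_restrict_of_subset hVU h
      rw [ae_iff, Measure.restrict_apply' hVo.measurableSet] at this
      refine measure_mono_null ?_ this
      exact fun β h => ⟨h.1.2, h.2⟩
  refine measure_mono_null ?_ (measure_union_null h1 ((countable_notGen hα).measure_zero volume))
  intro β hβ
  by_cases hg : Gen α β
  · exact Or.inl ⟨hg, hβ.2⟩
  · exact Or.inr ⟨hβ.1, hg⟩

open scoped Topology ENNReal

lemma measurable_Tab (α β : ℝ) : Measurable (Tab α β) := by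
  unfold Tab
  exact measurable_fract.comp ((measurable_id.const_mul β).add_const _)

lemma ii_of_bdd {f : ℝ → ℝ} (hf : Measurable f) {C : ℝ} (hC : ∀ y, |f y| ≤ C) (a b : ℝ) :
    IntervalIntegrable f volume a b := by
  rw [intervalIntegrable_iff]
  exact Measure.integrableOn_of_bounded (by simp) hf.aestronglyMeasurable
    (ae_of_all _ fun y => by rw [Real.norm_eq_abs]; exact hC y)

lemma int_step {α β : ℝ} (hβ : 1 < β) (hα : α ∈ Set.Ico (0:ℝ) 1) {f : ℝ → ℝ} (hf : Measurable f) {C : ℝ}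
    (hC : ∀ y, |f y| ≤ C) (z : ℝ) :
    ∫ y in (0:ℝ)..z, f (Tab α β y) = β⁻¹ * ((∫ y in (0:ℝ)..Tab α β z, f y) - (∫ y in (0:ℝ)..α, f y)
      + ⌊β * z + α⌋ * ∫ y in (0:ℝ)..1, f y) := by
  set φ : ℝ → ℝ := fun w => f (Int.fract w) with hφ
  have hφm : Measurable φ := hf.comp measurable_fract
  have hφC : ∀ y, |φ y| ≤ C := fun y => hC _
  have hI := ii_of_bdd hφm hφC
  have hper : Function.Periodic φ 1 := fun w => by simp [hφ]
  have h01 : ∀ w, 0 ≤ w → w < 1 → ∫ y in (0:ℝ)..w, φ y = ∫ y in (0:ℝ)..w, f y := by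
    intro w hw hw1
    apply intervalIntegral.integral_congr
    intro y hy
    rw [Set.uIcc_of_le hw] at hy
    simp only [hφ]
    rw [Int.fract_eq_self.mpr ⟨hy.1, hy.2.trans_lt hw1⟩]
  have h1 : ∫ y in (0:ℝ)..1, φ y = ∫ y in (0:ℝ)..1, f y := by
    apply intervalIntegral.integral_congr_ae
    have : ∀ᵐ y : ℝ, y ≠ 1 := by simp [ae_iff]
    filter_upwards [this] with y hy hy'
    rw [Set.uIoc_of_le zero_le_one] at hy'
    simp only [hφ]
    rw [Int.fract_eq_self.mpr ⟨hy'.1.le, lt_of_le_of_ne hy'.2 hy⟩]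
  have h2 : ∫ y in (0:ℝ)..z, f (Tab α β y) = β⁻¹ * ∫ w in α..(β*z+α), φ w := by
    have := intervalIntegral.integral_comp_mul_add (a := 0) (b := z) φ (c := β) (by linarith) α
    simp only [mul_zero, zero_add, smul_eq_mul] at this
    rw [← this]
    rfl
  have h3 : ∫ w in (0:ℝ)..(β*z+α), φ w = (∫ y in (0:ℝ)..Tab α β z, f y) +
      ⌊β * z + α⌋ * ∫ y in (0:ℝ)..1, f y := by
    have := hper.intervalIntegral_add_zsmul_eq ⌊β*z+α⌋ (Int.fract (β*z+α)) hI
    simp only [zsmul_eq_mul, mul_one, Int.fract_add_floor] at this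
    rw [← intervalIntegral.integral_add_adjacent_intervals (hI 0 (Int.fract (β*z+α))) (hI _ _),
      this, h01 _ (Int.fract_nonneg _) (Int.fract_lt_one _)]
    have h4 := hper.intervalIntegral_add_eq (Int.fract (β*z+α)) 0
    rw [zero_add] at h4
    rw [h4, h1]
    rfl
  rw [h2, ← h01 α hα.1 hα.2, ← intervalIntegral.integral_interval_sub_left (hI 0 _) (hI 0 α), h3]
  ring

/-- orbit primitives -/
noncomputable def prim (α β : ℝ) (f : ℝ → ℝ) (j : ℕ) (z : ℝ) : ℝ :=
  ∫ y in (0:ℝ)..z, f ((Tab α β)^[j] y)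

lemma prim_succ {α β : ℝ} (hβ : 1 < β) (hα : α ∈ Set.Ico (0:ℝ) 1) {f : ℝ → ℝ} (hf : Measurable f) {C : ℝ}
    (hC : ∀ y, |f y| ≤ C) (j : ℕ) (z : ℝ) :
    prim α β f (j+1) z = β⁻¹ * (prim α β f j (Tab α β z) - prim α β f j α
      + ⌊β * z + α⌋ * prim α β f j 1) :=
  int_step hβ hα (f := fun y => f ((Tab α β)^[j] y)) (hf.comp ((measurable_Tab α β).iterate j))
    (fun y => hC _) z

lemma prim_le {α β : ℝ} {f : ℝ → ℝ} {C : ℝ}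
    (hC : ∀ y, |f y| ≤ C) (j : ℕ) {z : ℝ} (hz : z ∈ Set.Icc (0:ℝ) 1) : |prim α β f j z| ≤ C := by
  have := intervalIntegral.norm_integral_le_of_norm_le_const (a := 0) (b := z)
    (f := fun y => f ((Tab α β)^[j] y)) (C := C) (fun y _ => by rw [Real.norm_eq_abs]; exact hC _)
  rw [Real.norm_eq_abs, sub_zero, abs_of_nonneg hz.1] at this
  have hC0 : 0 ≤ C := (abs_nonneg _).trans (hC 0)
  refine this.trans ?_
  nlinarith [hz.2]

lemma iter_bound {T g : ℝ → ℝ} {β R M : ℝ} (hβ : 1 < β) (hT : ∀ z ∈ Set.Icc (0:ℝ) 1, T z ∈ Set.Icc (0:ℝ) 1)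
    (hM : ∀ z ∈ Set.Icc (0:ℝ) 1, |g z| ≤ M)
    (h : ∀ z ∈ Set.Icc (0:ℝ) 1, |β * g z - g (T z)| ≤ R) :
    ∀ z ∈ Set.Icc (0:ℝ) 1, |g z| ≤ R / (β - 1) := by
  have hb : 0 < β - 1 := by linarith
  have hR : 0 ≤ R := (abs_nonneg _).trans (h 0 (by simp))
  have hM0 : 0 ≤ M := (abs_nonneg _).trans (hM 0 (by simp))
  have key : ∀ n : ℕ, ∀ z ∈ Set.Icc (0:ℝ) 1, |g z| ≤ R / (β - 1) + M * (β⁻¹)^n := by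
    intro n
    induction n with
    | zero =>
      intro z hz
      have : 0 ≤ R / (β-1) := by positivity
      have := hM z hz
      simp; linarith
    | succ n ih =>
      intro z hz
      have h1 := ih _ (hT z hz)
      have h2 := h z hz
      have h3 : β * |g z| ≤ R + |g (T z)| := by
        have : |β * g z| ≤ |β * g z - g (T z)| + |g (T z)| := by
          have := abs_add_le (β * g z - g (T z)) (g (T z))
          simpa using this
        rw [abs_mul, abs_of_pos (by linarith : (0:ℝ) < β)] at this
        linarith
      have h4 : β * (R / (β - 1) + M * (β⁻¹)^(n+1)) = R + (R/(β-1) + M * (β⁻¹)^n) := by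
        have : β ≠ 0 := by linarith
        rw [pow_succ]
        field_simp
        ring
      have : β * |g z| ≤ β * (R / (β - 1) + M * (β⁻¹)^(n+1)) := by linarith
      exact le_of_mul_le_mul_left this (by linarith)
  intro z hz
  have ht : Tendsto (fun n : ℕ => R / (β - 1) + M * (β⁻¹)^n) atTop (𝓝 (R/(β-1) + M * 0)) :=
    ((tendsto_pow_atTop_nhds_zero_of_lt_one (by positivity) (inv_lt_one_of_one_lt₀ hβ)).const_mul M).const_add _
  have := ge_of_tendsto' ht (fun n => key n z hz)
  simpa using this

lemma prim_cesaro {α β : ℝ} (hβ : 1 < β) (hα : α ∈ Set.Ico (0:ℝ) 1) {f : ℝ → ℝ} (hf : Measurable f) {C : ℝ}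
    (hC : ∀ y, |f y| ≤ C) : ∃ K : ℝ, ∀ J : ℕ, ∀ z ∈ Set.Icc (0:ℝ) 1,
      |∑ j ∈ Finset.range J, (prim α β f j z - z * prim α β f j 1)| ≤ K := by
  have hb : 0 < β - 1 := by linarith
  have hb0 : β ≠ 0 := by linarith
  have hC0 : 0 ≤ C := (abs_nonneg _).trans (hC 0)
  have hα' : α ∈ Set.Icc (0:ℝ) 1 := ⟨hα.1, hα.2.le⟩
  have hTm : ∀ z, Tab α β z ∈ Set.Icc (0:ℝ) 1 := fun z => ⟨Int.fract_nonneg _, (Int.fract_lt_one _).le⟩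
  refine ⟨2 * (2 * β * (2*C)) / (β - 1), fun J => ?_⟩
  set a := prim α β f with ha
  set E : ℝ → ℝ := fun z => ∑ j ∈ Finset.range J, (a j z - z * a j 1) with hE
  have hEb : ∀ z ∈ Set.Icc (0:ℝ) 1, |E z| ≤ J * (2 * C) := by
    intro z hz
    refine (Finset.abs_sum_le_sum_abs _ _).trans ?_
    refine (Finset.sum_le_card_nsmul _ _ (2*C) fun j _ => ?_).trans (by simp)
    have h1 := prim_le (α := α) (β := β) hC j hz
    have h2 := prim_le (α := α) (β := β) hC j (z := 1) (by simp)
    refine (abs_sub _ _).trans ?_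
    rw [abs_mul, abs_of_nonneg hz.1]
    have := hz.2
    have := abs_nonneg (prim α β f j 1)
    have := hz.1
    nlinarith
  have hrec : ∀ z ∈ Set.Icc (0:ℝ) 1, β * E z = E (Tab α β z) - E α - β * (a J z - a 0 z) := by
    intro z hz
    have h1 : ∀ j, a j z - z * a j 1 = (a j z - a (j+1) z) +
        β⁻¹ * ((a j (Tab α β z) - Tab α β z * a j 1) - (a j α - α * a j 1)) := by
      intro j
      have h2 : a (j+1) z = _ := prim_succ hβ hα hf hC j z
      have h3 : Tab α β z = β * z + α - ⌊β*z+α⌋ := rfl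
      rw [← ha] at h2
      rw [h2]
      generalize a j (Tab α β z) = p
      rw [h3]
      field_simp
      ring
    have h4 : E z = (a 0 z - a J z) + β⁻¹ * (E (Tab α β z) - E α) := by
      simp only [hE]
      rw [Finset.sum_congr rfl (fun j _ => h1 j), Finset.sum_add_distrib, Finset.sum_range_sub',
        ← Finset.mul_sum, Finset.sum_sub_distrib]
    rw [h4]
    field_simp
    ring
  have hg := iter_bound (T := Tab α β) (g := fun z => E z + E α / (β - 1)) (β := β) (R := 2 * β * C)
    (M := J * (2*C) + J * (2*C) / (β-1)) hβ (fun z _ => hTm z)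
    (fun z hz => by
      refine (abs_add_le _ _).trans ?_
      rw [abs_div, abs_of_pos hb]
      have := hEb z hz
      have := hEb α hα'
      gcongr)
    (fun z hz => by
      have h1 : β * (E z + E α / (β - 1)) - (E (Tab α β z) + E α / (β - 1)) = - (β * (a J z - a 0 z)) := by
        rw [mul_add, hrec z hz]
        field_simp
        ring
      simp only [h1, abs_neg]
      rw [abs_mul, abs_of_pos (by linarith : (0:ℝ) < β)]
      have h1 := prim_le (α := α) (β := β) hC J hz
      have h2 := prim_le (α := α) (β := β) hC 0 hz
      have := (abs_sub (a J z) (a 0 z)).trans (add_le_add h1 h2)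
      nlinarith)
  intro z hz
  have h0 := hg 0 (by simp)
  have hE0 : E 0 = 0 := by simp [hE, ha, prim]
  have hz' := hg z hz
  simp only [hE0, zero_add] at h0
  change |E z| ≤ _
  have : |E z| ≤ |E z + E α / (β-1)| + |E α / (β-1)| := by
    have := abs_sub (E z + E α / (β-1)) (E α / (β-1))
    simpa using this
  have e : 2 * (2 * β * (2*C)) / (β - 1) = 2 * β * C / (β - 1) + 2 * β * C / (β - 1) + (2 * β * C / (β - 1)
    + 2 * β * C / (β - 1)) := by ring
  have : 0 ≤ 2 * β * C / (β - 1) := by positivity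
  linarith

/-- Weak-star convergence from convergence of primitives -/
lemma weak_star {h : ℕ → ℝ → ℝ} {C : ℝ} (hm : ∀ J, Measurable (h J)) (hC : ∀ J y, |h J y| ≤ C)
    (hz : ∀ z ∈ Set.Icc (0:ℝ) 1, Tendsto (fun J => ∫ y in (0:ℝ)..z, h J y) atTop (𝓝 0))
    {g : ℝ → ℝ} (hg : Integrable g (volume.restrict (Set.Icc (0:ℝ) 1))) :
    Tendsto (fun J => ∫ y, h J y * g y ∂(volume.restrict (Set.Icc (0:ℝ) 1))) atTop (𝓝 0) := by
  set μ := volume.restrict (Set.Icc (0:ℝ) 1) with hμ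
  have hC0 : 0 ≤ C := (abs_nonneg _).trans (hC 0 0)
  have hint : ∀ J, Integrable (h J) μ := fun J =>
    Integrable.of_bound (hm J).aestronglyMeasurable C (ae_of_all _ fun y => hC J y)
  have hIio : ∀ z, Tendsto (fun J => ∫ y in Set.Iio z, h J y ∂μ) atTop (𝓝 0) := by
    intro z
    have : ∀ J, ∫ y in Set.Iio z, h J y ∂μ = ∫ y in (0:ℝ)..(max 0 (min z 1)), h J y := by
      intro J
      rw [intervalIntegral.integral_of_le (le_max_left _ _), hμ,
        Measure.restrict_restrict measurableSet_Iio]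
      apply setIntegral_congr_set
      have hn : ∀ᵐ y : ℝ, y ≠ 0 ∧ y ≠ z := by
        have h1 : ∀ᵐ y : ℝ, y ≠ 0 := by simp [ae_iff]
        have h2 : ∀ᵐ y : ℝ, y ≠ z := by simp [ae_iff]
        filter_upwards [h1, h2] with y a b using ⟨a, b⟩
      filter_upwards [hn] with y hy
      apply propext
      change (y ∈ Set.Iio z ∧ y ∈ Set.Icc 0 1) ↔ y ∈ Set.Ioc _ _
      simp only [Set.mem_Iio, Set.mem_Icc, Set.mem_Ioc, le_max_iff, le_min_iff]
      constructor
      · rintro ⟨a, b, c⟩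
        exact ⟨lt_of_le_of_ne b (Ne.symm hy.1), Or.inr ⟨a.le, c⟩⟩
      · rintro ⟨a, b | ⟨b, c⟩⟩
        · exact absurd b (not_le.mpr a)
        · exact ⟨lt_of_le_of_ne b hy.2, a.le, c⟩
    simp only [this]
    apply hz
    exact ⟨le_max_left _ _, max_le zero_le_one (min_le_right _ _)⟩
  have huniv : Tendsto (fun J => ∫ y, h J y ∂μ) atTop (𝓝 0) := by
    have := hz 1 (by simp)
    refine this.congr fun J => ?_
    rw [intervalIntegral.integral_of_le zero_le_one, ← integral_Icc_eq_integral_Ioc]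
  have hset : ∀ s, MeasurableSet s → Tendsto (fun J => ∫ y in s, h J y ∂μ) atTop (𝓝 0) := by
    intro s hs
    induction s, hs using MeasurableSpace.induction_on_inter
      (borel_eq_generateFrom_Iio ℝ ▸ BorelSpace.measurable_eq) isPiSystem_Iio with
    | empty => simp
    | basic t ht =>
      obtain ⟨z, rfl⟩ := ht
      exact hIio z
    | compl t ht ih =>
      have := huniv.sub ih
      rw [sub_zero] at this
      refine this.congr fun J => ?_
      rw [← integral_add_compl ht (hint J)]; ring
    | iUnion F hd hF ih =>
      have e : ∀ J, ∫ y in ⋃ i, F i, h J y ∂μ = ∑' i, ∫ y in F i, h J y ∂μ := fun J =>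
        integral_iUnion hF hd (hint J).integrableOn
      simp only [e]
      rw [show (0:ℝ) = ∑' i : ℕ, (0:ℝ) by simp]
      refine tendsto_tsum_of_dominated_convergence (bound := fun i => C * μ.real (F i)) ?_ ih ?_
      · apply Summable.mul_left
        apply ENNReal.summable_toReal
        rw [← measure_iUnion hd hF]
        exact measure_ne_top _ _
      · refine Eventually.of_forall fun J i => ?_
        exact norm_setIntegral_le_of_norm_le_const (measure_lt_top _ _) (fun y _ => hC J y)
  have hmul : ∀ J (g : ℝ → ℝ), Integrable g μ → Integrable (fun y => h J y * g y) μ := fun J g hg =>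
    hg.bdd_mul (c := C) (hm J).aestronglyMeasurable (ae_of_all _ fun y => hC J y)
  refine Integrable.induction (fun g => Tendsto (fun J => ∫ y, h J y * g y ∂μ) atTop (𝓝 0)) ?_ ?_ ?_ ?_ hg
  · intro c s hs _
    have := (hset _ hs).mul_const c
    rw [zero_mul] at this
    refine this.congr fun J => ?_
    rw [← integral_mul_const, ← integral_indicator hs]
    refine integral_congr_ae (ae_of_all _ fun y => ?_)
    by_cases hy : y ∈ s
    · simp [hy]
    · simp [hy]
  · intro f1 f2 hd h1 h2 i1 i2
    have := i1.add i2
    rw [add_zero] at this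
    refine this.congr fun J => ?_
    rw [← integral_add (hmul J _ h1) (hmul J _ h2)]
    congr 1
    funext y
    simp only [Pi.add_apply]
    ring
  · rw [← isSeqClosed_iff_isClosed]
    intro u p hu hp
    change Tendsto _ _ _
    rw [Metric.tendsto_atTop]
    intro ε hε
    obtain ⟨N, hN⟩ := Metric.tendsto_atTop.mp hp (ε / (2 * (C+1))) (by positivity)
    obtain ⟨J0, hJ0⟩ := Metric.tendsto_atTop.mp (hu N) (ε/2) (by positivity)
    refine ⟨J0, fun J hJ => ?_⟩
    have h1 := hJ0 J hJ
    have h2 := hN N le_rfl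
    rw [Real.dist_eq, sub_zero] at h1 ⊢
    rw [L1.dist_eq_integral_dist] at h2
    have h3 : |∫ y, h J y * p y ∂μ - ∫ y, h J y * u N y ∂μ| ≤ C * ∫ y, dist (u N y) (p y) ∂μ := by
      rw [← integral_sub (hmul J _ (L1.integrable_coeFn p)) (hmul J _ (L1.integrable_coeFn (u N))),
        ← integral_const_mul]
      rw [← Real.norm_eq_abs]
      refine norm_integral_le_of_norm_le ?_ (ae_of_all _ fun y => ?_)
      · exact (((L1.integrable_coeFn (u N)).sub (L1.integrable_coeFn p)).norm).const_mul C
      · rw [← mul_sub, norm_mul, Real.dist_eq, abs_sub_comm]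
        have := hC J y
        rw [Real.norm_eq_abs, Real.norm_eq_abs]
        gcongr
    have h4 : C * ∫ y, dist (u N y) (p y) ∂μ ≤ ε/2 := by
      calc C * ∫ y, dist (u N y) (p y) ∂μ ≤ (C+1) * (ε / (2 * (C+1))) := by
            gcongr
            linarith
        _ = ε/2 := by field_simp
    have h5 := abs_sub_abs_le_abs_sub (∫ y, h J y * p y ∂μ) (∫ y, h J y * u N y ∂μ)
    linarith
  · intro f1 f2 hfg _ ih
    refine ih.congr fun J => integral_congr_ae ?_
    filter_upwards [hfg] with y hy
    rw [hy]

open scoped Topology ENNReal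

/-- Lebesgue measure on the unit interval -/
noncomputable abbrev lam : Measure ℝ := volume.restrict (Set.Icc (0:ℝ) 1)

/-- Cesaro means of the integrals of the iterates -/
noncomputable def cbar (α β : ℝ) (f : ℝ → ℝ) (J : ℕ) : ℝ :=
  (J:ℝ)⁻¹ * ∑ j ∈ Finset.range J, prim α β f j 1

lemma inv_lim {α β : ℝ} (hβ : 1 < β) (hα : α ∈ Set.Ico (0:ℝ) 1) {g : ℝ → ℝ} (hg : Integrable g lam)
    (hinv : ∀ f : ℝ → ℝ, Measurable f → ∀ C, (∀ y, |f y| ≤ C) →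
      ∫ y, f (Tab α β y) * g y ∂lam = ∫ y, f y * g y ∂lam)
    {f : ℝ → ℝ} (hf : Measurable f) {C : ℝ} (hC : ∀ y, |f y| ≤ C) :
    Tendsto (fun J => (∫ y, f y * g y ∂lam) - cbar α β f J * ∫ y, g y ∂lam) atTop (𝓝 0) := by
  obtain ⟨K, hK⟩ := prim_cesaro hβ hα hf hC
  have hC0 : 0 ≤ C := (abs_nonneg _).trans (hC 0)
  have hfj : ∀ j, Measurable fun y => f ((Tab α β)^[j] y) := fun j =>
    hf.comp ((measurable_Tab α β).iterate j)
  have hinvj : ∀ j, ∫ y, f ((Tab α β)^[j] y) * g y ∂lam = ∫ y, f y * g y ∂lam := by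
    intro j
    induction j with
    | zero => rfl
    | succ j ih =>
      rw [← ih]
      exact hinv (fun y => f ((Tab α β)^[j] y)) (hfj j) C (fun y => hC _)
  have hgj : ∀ j, Integrable (fun y => f ((Tab α β)^[j] y) * g y) lam := fun j =>
    hg.bdd_mul (c := C) (hfj j).aestronglyMeasurable (ae_of_all _ fun y => hC _)
  have hsum : ∀ (J : ℕ) (u : ℕ → ℝ), (∀ j, |u j| ≤ C) → |(J:ℝ)⁻¹ * ∑ j ∈ Finset.range J, u j| ≤ C := by
    intro J u hu
    rcases Nat.eq_zero_or_pos J with h | h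
    · simp [h, hC0]
    · have hJ : (0:ℝ) < J := by exact_mod_cast h
      rw [abs_mul, abs_of_pos (by positivity : (0:ℝ) < (J:ℝ)⁻¹), inv_mul_le_iff₀ hJ]
      refine (Finset.abs_sum_le_sum_abs _ _).trans ?_
      exact (Finset.sum_le_card_nsmul _ _ C fun j _ => hu j).trans (by simp)
  set h : ℕ → ℝ → ℝ := fun J y =>
    (J:ℝ)⁻¹ * ∑ j ∈ Finset.range J, f ((Tab α β)^[j] y) - cbar α β f J with hh
  have key := weak_star (h := h) (C := 2*C) (fun J => by
      refine Measurable.sub_const (Measurable.const_mul ?_ _) _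
      exact Finset.measurable_sum _ fun j _ => hfj j)
    (fun J y => by
      have h1 := hsum J (fun j => f ((Tab α β)^[j] y)) (fun j => hC _)
      have h2 := hsum J (fun j => prim α β f j 1) (fun j => prim_le hC j (by simp))
      have := (abs_sub ((J:ℝ)⁻¹ * ∑ j ∈ Finset.range J, f ((Tab α β)^[j] y)) (cbar α β f J)).trans
        (add_le_add h1 h2)
      simp only [hh]
      linarith)
    (fun z hz => by
      have e : ∀ J, ∫ y in (0:ℝ)..z, h J y =
          (J:ℝ)⁻¹ * ∑ j ∈ Finset.range J, (prim α β f j z - z * prim α β f j 1) := by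
        intro J
        have hii : ∀ j, IntervalIntegrable (fun y => f ((Tab α β)^[j] y)) volume 0 z := fun j =>
          ii_of_bdd (hfj j) (fun y => hC _) _ _
        simp only [hh]
        rw [intervalIntegral.integral_sub, intervalIntegral.integral_const_mul,
          intervalIntegral.integral_finsetSum (fun j _ => hii j), intervalIntegral.integral_const,
          Finset.sum_sub_distrib, ← Finset.mul_sum, cbar]
        · simp only [prim, smul_eq_mul, sub_zero]; ring
        · apply IntervalIntegrable.const_mul
          have := IntervalIntegrable.sum (Finset.range J) (fun j _ => hii j)
          rw [show (fun y => ∑ j ∈ Finset.range J, f ((Tab α β)^[j] y)) =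
            ∑ j ∈ Finset.range J, fun y => f ((Tab α β)^[j] y) from by funext y; simp]
          exact this
        · exact intervalIntegrable_const
      simp only [e]
      refine squeeze_zero_norm (a := fun J : ℕ => (J:ℝ)⁻¹ * K) (fun J => ?_) ?_
      · rw [Real.norm_eq_abs, abs_mul, abs_of_nonneg (by positivity : (0:ℝ) ≤ (J:ℝ)⁻¹)]
        gcongr
        exact hK J z hz
      · have := (tendsto_inv_atTop_nhds_zero_nat (𝕜 := ℝ)).mul_const K
        simpa using this) hg
  refine key.congr' ?_
  filter_upwards [eventually_gt_atTop 0] with J hJ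
  have hJ' : (J:ℝ) ≠ 0 := by positivity
  have e : ∀ y, h J y * g y = (J:ℝ)⁻¹ * ∑ j ∈ Finset.range J, f ((Tab α β)^[j] y) * g y
      - cbar α β f J * g y := by
    intro y; simp only [hh]; rw [← Finset.sum_mul]; ring
  simp only [e]
  rw [integral_sub, integral_const_mul, integral_const_mul, integral_finsetSum _ (fun j _ => hgj j)]
  · simp only [hinvj, Finset.sum_const, Finset.card_range, nsmul_eq_mul]
    field_simp
  · exact (integrable_finsetSum _ (fun j _ => hgj j)).const_mul _
  · exact hg.const_mul _

/-- summands of the Parry density -/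
noncomputable def pterm (α β : ℝ) (n : ℕ) (x : ℝ) : ℝ := ((if x < (Tab α β)^[n] 1 then (1 : ℝ) else 0)
    - (if x < (Tab α β)^[n] 0 then (1 : ℝ) else 0)) / β ^ (n + 1)

lemma pterm_le {α β : ℝ} (hβ : 1 < β) (n : ℕ) (x : ℝ) : |pterm α β n x| ≤ (β⁻¹)^(n+1) := by
  unfold pterm
  rw [abs_div, abs_of_pos (by positivity : 0 < β^(n+1)), inv_pow, div_eq_mul_inv]
  have : 0 < (β^(n+1))⁻¹ := by positivity
  have h : |((if x < (Tab α β)^[n] 1 then (1 : ℝ) else 0)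
    - (if x < (Tab α β)^[n] 0 then (1 : ℝ) else 0))| ≤ 1 := by
    split_ifs <;> simp
  nlinarith

lemma summable_geo {β : ℝ} (hβ : 1 < β) : Summable fun n : ℕ => (β⁻¹)^(n+1) :=
  (summable_nat_add_iff 1).mpr (summable_geometric_of_lt_one (by positivity) (inv_lt_one_of_one_lt₀ hβ))

lemma measurable_pterm (α β : ℝ) (n : ℕ) : Measurable (pterm α β n) := by
  unfold pterm
  refine Measurable.div_const (Measurable.sub ?_ ?_) _
  · exact Measurable.ite measurableSet_Iio measurable_const measurable_const
  · exact Measurable.ite measurableSet_Iio measurable_const measurable_const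

lemma hasSum_pterm {α β : ℝ} (hβ : 1 < β) (x : ℝ) :
    HasSum (fun n => pterm α β n x) (parryG α β x) :=
  (Summable.of_norm_bounded (summable_geo hβ) (fun n => pterm_le hβ n x)).hasSum

lemma measurable_parryG {α β : ℝ} (hβ : 1 < β) : Measurable (parryG α β) := by
  refine measurable_of_tendsto_metrizable (f := fun N x => ∑ n ∈ Finset.range N, pterm α β n x)
    (fun N => Finset.measurable_sum _ fun n _ => measurable_pterm α β n) ?_
  rw [tendsto_pi_nhds]
  intro x
  exact (hasSum_pterm hβ x).tendsto_sum_nat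

lemma integrable_parryG {α β : ℝ} (hβ : 1 < β) : Integrable (parryG α β) lam := by
  refine Integrable.of_bound (measurable_parryG hβ).aestronglyMeasurable (∑' n : ℕ, (β⁻¹)^(n+1))
    (ae_of_all _ fun x => ?_)
  exact tsum_of_norm_bounded (summable_geo hβ).hasSum (fun n => pterm_le hβ n x)

lemma int_lt {f : ℝ → ℝ} {z : ℝ} (hz : z ∈ Set.Icc (0:ℝ) 1) :
    ∫ y, f y * (if y < z then (1:ℝ) else 0) ∂lam = ∫ y in (0:ℝ)..z, f y := by
  have : (fun y => f y * (if y < z then (1:ℝ) else 0)) = (Set.Iio z).indicator f := by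
    funext y
    simp only [Set.indicator_apply, Set.mem_Iio]
    split_ifs <;> simp
  rw [this, integral_indicator measurableSet_Iio, Measure.restrict_restrict measurableSet_Iio,
    intervalIntegral.integral_of_le hz.1, ← integral_Ico_eq_integral_Ioc]
  congr 2
  ext y
  simp only [Set.mem_inter_iff, Set.mem_Iio, Set.mem_Icc, Set.mem_Ico]
  constructor
  · rintro ⟨a, b, c⟩; exact ⟨b, a⟩
  · rintro ⟨a, b⟩; exact ⟨b, a, b.le.trans hz.2⟩

lemma hasSum_int_parryG {α β : ℝ} (hβ : 1 < β) {f : ℝ → ℝ} (hf : Measurable f) {C : ℝ}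
    (hC : ∀ y, |f y| ≤ C) :
    HasSum (fun n => ((∫ y in (0:ℝ)..(Tab α β)^[n] 1, f y) - ∫ y in (0:ℝ)..(Tab α β)^[n] 0, f y)
      / β^(n+1)) (∫ y, f y * parryG α β y ∂lam) := by
  have hC0 : 0 ≤ C := (abs_nonneg _).trans (hC 0)
  have hfi : Integrable f lam := Integrable.of_bound hf.aestronglyMeasurable C (ae_of_all _ hC)
  have hF : ∀ n, Integrable (fun y => f y * pterm α β n y) lam := fun n =>
    hfi.mul_bdd (c := (β⁻¹)^(n+1)) (measurable_pterm α β n).aestronglyMeasurable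
      (ae_of_all _ fun y => pterm_le hβ n y)
  have hs : Summable fun n => ∫ y, ‖f y * pterm α β n y‖ ∂lam := by
    refine Summable.of_nonneg_of_le (fun n => integral_nonneg fun y => norm_nonneg _) (fun n => ?_)
      ((summable_geo hβ).mul_left C)
    have := integral_mono (μ := lam) (hF n).norm (integrable_const (C * (β⁻¹)^(n+1))) (fun y => by
      simp only [norm_mul]
      exact mul_le_mul (hC y) (pterm_le hβ n y) (norm_nonneg _) hC0)
    simpa using this
  have := hasSum_integral_of_summable_integral_norm hF hs
  have e : ∀ y, ∑' n, f y * pterm α β n y = f y * parryG α β y := fun y =>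
    ((hasSum_pterm hβ y).mul_left (f y)).tsum_eq
  simp only [e] at this
  suffices H : ∀ n, ((∫ y in (0:ℝ)..(Tab α β)^[n] 1, f y) - ∫ y in (0:ℝ)..(Tab α β)^[n] 0, f y)
      / β^(n+1) = ∫ y, f y * pterm α β n y ∂lam by
    simp only [H]; exact this
  intro n
  have h1 : (Tab α β)^[n] 1 ∈ Set.Icc (0:ℝ) 1 := iter_mem_Icc α β (by simp) n
  have h0 : (Tab α β)^[n] 0 ∈ Set.Icc (0:ℝ) 1 := iter_mem_Icc α β (by simp) n
  rw [← int_lt h1, ← int_lt h0, ← integral_sub, ← integral_div]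
  · congr 1
    funext y
    unfold pterm
    ring
  · exact hfi.mul_bdd (c := 1) (Measurable.ite measurableSet_Iio measurable_const
      measurable_const).aestronglyMeasurable (ae_of_all _ fun y => by split_ifs <;> simp)
  · exact hfi.mul_bdd (c := 1) (Measurable.ite measurableSet_Iio measurable_const
      measurable_const).aestronglyMeasurable (ae_of_all _ fun y => by split_ifs <;> simp)

lemma parryG_inv {α β : ℝ} (hβ : 1 < β) (hα : α ∈ Set.Ico (0:ℝ) 1) (f : ℝ → ℝ) (hf : Measurable f) (C : ℝ)
    (hC : ∀ y, |f y| ≤ C) :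
    ∫ y, f (Tab α β y) * parryG α β y ∂lam = ∫ y, f y * parryG α β y ∂lam := by
  have s1 := hasSum_int_parryG (α := α) hβ hf hC
  have s2 := hasSum_int_parryG (α := α) hβ (f := fun y => f (Tab α β y)) (hf.comp (measurable_Tab α β))
    (fun y => hC _)
  set a : ℝ → ℝ := fun z => ∫ y in (0:ℝ)..z, f y with ha
  set p : ℕ → ℝ := fun n => ((Tab α β)^[n] 1 - (Tab α β)^[n] 0) / β^n with hp
  have hb0 : β ≠ 0 := by linarith
  have e : ∀ n, ((∫ y in (0:ℝ)..(Tab α β)^[n] 1, f (Tab α β y)) -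
      ∫ y in (0:ℝ)..(Tab α β)^[n] 0, f (Tab α β y)) / β^(n+1) =
      (a ((Tab α β)^[n+1] 1) - a ((Tab α β)^[n+1] 0)) / β^(n+1+1) +
      β⁻¹ * a 1 * (p n - p (n+1)) := by
    intro n
    rw [int_step hβ hα hf hC, int_step hβ hα hf hC]
    simp only [hp, Function.iterate_succ_apply']
    set y1 := (Tab α β)^[n] 1
    set y0 := (Tab α β)^[n] 0
    have h1 : (⌊β * y1 + α⌋ : ℝ) = β * y1 + α - Tab α β y1 := by
      unfold Tab; rw [Int.self_sub_fract]
    have h0 : (⌊β * y0 + α⌋ : ℝ) = β * y0 + α - Tab α β y0 := by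
      unfold Tab; rw [Int.self_sub_fract]
    rw [h1, h0]
    simp only [ha]
    rw [pow_succ β (n+1), pow_succ β n]
    field_simp
    ring
  have hp0 : Tendsto p atTop (𝓝 0) := by
    refine squeeze_zero_norm (a := fun n : ℕ => (β⁻¹)^n) (fun n => ?_)
      (tendsto_pow_atTop_nhds_zero_of_lt_one (by positivity) (inv_lt_one_of_one_lt₀ hβ))
    have h1 : (Tab α β)^[n] 1 ∈ Set.Icc (0:ℝ) 1 := iter_mem_Icc α β (by simp) n
    have h0 : (Tab α β)^[n] 0 ∈ Set.Icc (0:ℝ) 1 := iter_mem_Icc α β (by simp) n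
    simp only [hp]
    rw [Real.norm_eq_abs, abs_div, abs_of_pos (by positivity : 0 < β^n), inv_pow, div_eq_mul_inv]
    have : 0 < (β^n)⁻¹ := by positivity
    have h : |(Tab α β)^[n] 1 - (Tab α β)^[n] 0| ≤ 1 := by
      rw [abs_le]; exact ⟨by linarith [h1.1, h0.2], by linarith [h1.2, h0.1]⟩
    nlinarith
  refine tendsto_nhds_unique s2.tendsto_sum_nat ?_
  simp only [e]
  have hp1 : p 0 = 1 := by simp [hp]
  have e2 : ∀ M, ∑ n ∈ Finset.range M, ((a ((Tab α β)^[n+1] 1) - a ((Tab α β)^[n+1] 0)) / β^(n+1+1) +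
      β⁻¹ * a 1 * (p n - p (n+1))) =
      ∑ n ∈ Finset.range (M+1), ((a ((Tab α β)^[n] 1) - a ((Tab α β)^[n] 0)) / β^(n+1)) -
        β⁻¹ * a 1 * p M := by
    intro M
    have ha0 : a 0 = 0 := by simp [ha]
    rw [Finset.sum_add_distrib, ← Finset.mul_sum, Finset.sum_range_sub', hp1,
      Finset.sum_range_succ' (fun n => (a ((Tab α β)^[n] 1) - a ((Tab α β)^[n] 0)) / β^(n+1))]
    simp only [Function.iterate_zero, id, ha0, zero_add, pow_one, sub_zero]
    field_simp
    ring
  simp only [e2]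
  have := ((tendsto_add_atTop_iff_nat 1).mpr s1.tendsto_sum_nat).sub (hp0.const_mul (β⁻¹ * a 1))
  simpa using this

lemma parryG_pos_near {α β : ℝ} (hβ : 1 < β) : ∃ l < 1, ∀ y ∈ Set.Ioo l 1, 0 < parryG α β y := by
  have key : Tendsto (fun y => ∑' n, pterm α β n y) (𝓝[<] 1)
      (𝓝 (∑' n : ℕ, if n = 0 then β⁻¹ else 0)) := by
    refine tendsto_tsum_of_dominated_convergence (summable_geo hβ) (fun n => ?_)
      (Eventually.of_forall fun y n => pterm_le hβ n y)
    apply tendsto_const_nhds.congr'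
    have hlt : ∀ w : ℝ, w < 1 → ∀ᶠ y in 𝓝[<] (1:ℝ), w < y := fun w hw =>
      mem_nhdsWithin_of_mem_nhds (lt_mem_nhds hw)
    cases n with
    | zero =>
      filter_upwards [self_mem_nhdsWithin, hlt 0 one_pos] with y hy hy0
      have hy : y < 1 := hy
      simp [pterm, hy, not_lt.mpr hy0.le]
    | succ n =>
      have h1 : (Tab α β)^[n+1] 1 < 1 := by
        rw [Function.iterate_succ_apply']; exact Int.fract_lt_one _
      have h0 : (Tab α β)^[n+1] 0 < 1 := by
        rw [Function.iterate_succ_apply']; exact Int.fract_lt_one _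
      filter_upwards [hlt _ h1, hlt _ h0] with y hy1 hy0
      rw [pterm, if_neg (not_lt.mpr hy1.le), if_neg (not_lt.mpr hy0.le)]; simp
  rw [tsum_ite_eq] at key
  have hb : 0 < β⁻¹ := by positivity
  have := key.eventually (lt_mem_nhds hb)
  obtain ⟨l, hl, h⟩ := (mem_nhdsLT_iff_exists_Ioo_subset' (show (0:ℝ) < 1 from one_pos)).mp this
  exact ⟨l, hl, fun y hy => h hy⟩

lemma parryN_ne {α β : ℝ} (hβ : 1 < β) (hα : α ∈ Set.Ico (0:ℝ) 1) : parryN α β ≠ 0 := by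
  intro hN
  have hN' : ∫ y, parryG α β y ∂lam = 0 := hN
  have h1 : ∀ s, MeasurableSet s → ∫ y in s, parryG α β y ∂lam = 0 := by
    intro s hs
    have := inv_lim hβ hα (integrable_parryG hβ) (parryG_inv hβ hα) (f := s.indicator 1)
      (measurable_one.indicator hs) (C := 1) (fun y => by
        by_cases h : y ∈ s <;> simp [h])
    simp only [hN', mul_zero, sub_zero] at this
    have := tendsto_nhds_unique this tendsto_const_nhds
    rw [← integral_indicator hs, this]
    congr 1
    funext y
    by_cases h : y ∈ s <;> simp [h]
  have h2 := (integrable_parryG (α := α) hβ).ae_eq_zero_of_forall_setIntegral_eq_zero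
    (fun s hs _ => h1 s hs)
  obtain ⟨l, hl, hpos⟩ := parryG_pos_near (α := α) hβ
  have h3 : lam (Set.Ioo (max l 0) 1) = 0 := by
    refine measure_mono_null ?_ h2
    intro y hy h
    have := hpos y ⟨(le_max_left _ _).trans_lt hy.1, hy.2⟩
    have h' : parryG α β y = 0 := h
    linarith
  have hsub : Set.Ioo (max l 0) 1 ⊆ Set.Icc (0:ℝ) 1 := fun y hy =>
    ⟨(le_max_right _ _).trans hy.1.le, hy.2.le⟩
  rw [Measure.restrict_apply measurableSet_Ioo, Set.inter_eq_left.mpr hsub, Real.volume_Ioo, ENNReal.ofReal_eq_zero] at h3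
  have : max l 0 < 1 := max_lt hl one_pos
  linarith

open scoped Topology ENNReal

lemma parry_unique {α β : ℝ} (hβ : 1 < β) (hα : α ∈ Set.Ico (0:ℝ) 1) (ν : Measure ℝ)
    [IsProbabilityMeasure ν] (hac : ν ≪ volume) (hsupp : ν (Set.Icc (0:ℝ) 1)ᶜ = 0)
    (hinv : ν.map (Tab α β) = ν) : ν = parryMeasure α β := by
  have hac' : ν ≪ lam := by
    refine Measure.AbsolutelyContinuous.mk fun s hs h => ?_
    rw [Measure.restrict_apply hs] at h
    refine measure_mono_null ?_ (measure_union_null (hac h) hsupp)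
    intro y hy
    by_cases h' : y ∈ Set.Icc (0:ℝ) 1
    · exact Or.inl ⟨hy, h'⟩
    · exact Or.inr h'
  set g : ℝ → ℝ := fun y => (ν.rnDeriv lam y).toReal with hg
  have hgi : Integrable g lam := Measure.integrable_toReal_rnDeriv
  have hint : ∀ f : ℝ → ℝ, ∫ y, f y * g y ∂lam = ∫ y, f y ∂ν := by
    intro f
    rw [← integral_rnDeriv_smul hac']
    simp only [hg, smul_eq_mul, mul_comm]
  have hg1 : ∫ y, g y ∂lam = 1 := by
    have := hint (fun _ => 1)
    simpa using this
  have hginv : ∀ f : ℝ → ℝ, Measurable f → ∀ C, (∀ y, |f y| ≤ C) →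
      ∫ y, f (Tab α β y) * g y ∂lam = ∫ y, f y * g y ∂lam := by
    intro f hf C hC
    rw [hint (fun y => f (Tab α β y)), hint f]
    conv_rhs => rw [← hinv]
    rw [integral_map (measurable_Tab α β).aemeasurable hf.aestronglyMeasurable]
  have hN := parryN_ne hβ hα
  have hNd : ∫ y, parryG α β y ∂lam = parryN α β := rfl
  have key : ∀ f : ℝ → ℝ, Measurable f → ∀ C, (∀ y, |f y| ≤ C) →
      ∫ y, f y * parryG α β y ∂lam = parryN α β * ∫ y, f y ∂ν := by
    intro f hf C hC
    have h1 := inv_lim hβ hα hgi hginv hf hC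
    have h2 := inv_lim hβ hα (integrable_parryG hβ) (parryG_inv hβ hα) hf hC
    rw [hint f, hg1] at h1
    rw [hNd] at h2
    have h3 := h2.sub (h1.const_mul (parryN α β))
    have h4 : ∀ J, (∫ y, f y * parryG α β y ∂lam) - cbar α β f J * parryN α β -
      parryN α β * ((∫ y, f y ∂ν) - cbar α β f J * 1) =
      (∫ y, f y * parryG α β y ∂lam) - parryN α β * ∫ y, f y ∂ν := fun J => by ring
    simp only [h4] at h3
    have := tendsto_nhds_unique h3 tendsto_const_nhds
    linarith
  set d : ℝ → ℝ := fun y => parryG α β y / parryN α β with hd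
  have hdi : Integrable d lam := (integrable_parryG hβ).div_const _
  have hset : ∀ s, MeasurableSet s → ∫ y in s, d y ∂lam = ν.real s := by
    intro s hs
    have := key (s.indicator 1) (measurable_one.indicator hs) 1 (fun y => by
        by_cases h : y ∈ s <;> simp [h])
    rw [integral_indicator_one hs] at this
    have e : ∫ y, s.indicator 1 y * parryG α β y ∂lam = ∫ y in s, parryG α β y ∂lam := by
      rw [← integral_indicator hs]
      refine integral_congr_ae (ae_of_all _ fun y => ?_)
      by_cases h : y ∈ s <;> simp [h]
    rw [e] at this
    simp only [hd]
    rw [integral_div, this]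
    field_simp
  have hpos : 0 ≤ᵐ[lam] d := ae_nonneg_of_forall_setIntegral_nonneg hdi (fun s hs _ => by
    rw [hset s hs]; exact measureReal_nonneg)
  ext s hs
  unfold parryMeasure
  rw [withDensity_apply _ hs]
  change _ = ∫⁻ y in s, ENNReal.ofReal (d y) ∂lam
  rw [← ofReal_integral_eq_lintegral_ofReal hdi.integrableOn (ae_restrict_of_ae hpos), hset s hs,
    ofReal_measureReal]

open scoped Topology ENNReal NNReal

lemma stieltjes_limit {F : ℝ → ℝ} {D : ℝ} (hD : 0 ≤ D) (hmono : Monotone F)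
    (hlip : ∀ y y', y ≤ y' → F y' - F y ≤ D * (y' - y))
    (h0 : ∀ y ≤ 0, F y = 0) (h1 : ∀ y, 1 ≤ y → F y = 1) :
    ∃ ν : Measure ℝ, IsProbabilityMeasure ν ∧ ν ≪ volume ∧ ν (Set.Icc (0:ℝ) 1)ᶜ = 0 ∧
      ∀ y, ν.real (Set.Iio y) = F y := by
  let D' : ℝ≥0 := ⟨D, hD⟩
  have hlip' : LipschitzWith D' F := by
    apply LipschitzWith.of_le_add_mul
    intro y y'
    change F y ≤ F y' + D * dist y y'
    rcases le_total y y' with h | h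
    · have := hmono h
      have : 0 ≤ D * dist y y' := by positivity
      linarith
    · have := hlip _ _ h
      rw [Real.dist_eq, abs_of_nonneg (by linarith)]
      linarith
  have hcont : Continuous F := hlip'.continuous
  let S : StieltjesFunction ℝ := ⟨F, hmono, fun y => hcont.continuousWithinAt⟩
  let S2 : StieltjesFunction ℝ := ⟨fun y => D * y - F y, fun y y' h => by
    have := hlip _ _ h
    simp only; linarith, fun y => by
    apply Continuous.continuousWithinAt; fun_prop⟩
  have hS : S + S2 = D' • StieltjesFunction.id := by
    ext y
    change F y + (D * y - F y) = D * y
    ring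
  have hle : S.measure + S2.measure = D' • volume := by
    rw [← StieltjesFunction.measure_add, hS, StieltjesFunction.measure_smul, Real.volume_eq_stieltjes_id]
  have hac : S.measure ≪ volume := by
    refine Measure.AbsolutelyContinuous.mk fun s _ h => ?_
    have : (S.measure + S2.measure) s = 0 := by rw [hle]; simp [h]
    rw [Measure.add_apply] at this
    exact (add_eq_zero.mp this).1
  have hbot : Tendsto S atBot (𝓝 0) := by
    apply tendsto_const_nhds.congr'
    filter_upwards [eventually_le_atBot 0] with y hy
    exact (h0 y hy).symm
  have htop : Tendsto S atTop (𝓝 1) := by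
    apply tendsto_const_nhds.congr'
    filter_upwards [eventually_ge_atTop 1] with y hy
    exact (h1 y hy).symm
  have hIic : ∀ y, S.measure (Set.Iic y) = ENNReal.ofReal (F y) := by
    intro y
    rw [S.measure_Iic hbot, sub_zero]
  have hIio : ∀ y, S.measure (Set.Iio y) = ENNReal.ofReal (F y) := by
    intro y
    rw [← hIic]
    exact measure_congr (hac.ae_eq Iio_ae_eq_Iic)
  have hF0 : ∀ y, 0 ≤ F y := fun y => by
    rw [← h0 (min y 0) (min_le_right _ _)]; exact hmono (min_le_left _ _)
  refine ⟨S.measure, S.isProbabilityMeasure hbot htop, hac, ?_, fun y => ?_⟩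
  · have : (Set.Icc (0:ℝ) 1)ᶜ ⊆ Set.Iio 0 ∪ Set.Ioi 1 := by
      intro y hy
      by_contra h
      rw [Set.mem_union, not_or, Set.mem_Iio, Set.mem_Ioi, not_lt, not_lt] at h
      exact hy h
    refine measure_mono_null this (measure_union_null ?_ ?_)
    · rw [hIio, h0 0 le_rfl]; simp
    · rw [S.measure_Ioi htop]
      change ENNReal.ofReal (1 - F 1) = 0
      rw [h1 1 le_rfl]; simp
  · rw [measureReal_def, hIio, ENNReal.toReal_ofReal (hF0 y)]

/-- indicator of a left half line -/
noncomputable def lt1 (y ξ : ℝ) : ℝ := if ξ < y then 1 else 0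

lemma lt1_eq (y : ℝ) : lt1 y = (Set.Iio y).indicator 1 := by
  funext ξ
  by_cases h : ξ < y <;> simp [lt1, h]

lemma measurable_lt1 (y : ℝ) : Measurable (lt1 y) := by
  rw [lt1_eq]; exact measurable_one.indicator measurableSet_Iio

lemma integral_lt1 (ν : Measure ℝ) (y : ℝ) : ∫ ξ, lt1 y ξ ∂ν = ν.real (Set.Iio y) := by
  rw [lt1_eq, integral_indicator_one measurableSet_Iio]

lemma lt1_nonneg (y ξ : ℝ) : 0 ≤ lt1 y ξ := by unfold lt1; split_ifs <;> simp
lemma lt1_le (y ξ : ℝ) : lt1 y ξ ≤ 1 := by unfold lt1; split_ifs <;> simp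

lemma integrable_lt1 (ν : Measure ℝ) [IsFiniteMeasure ν] (y : ℝ) : Integrable (lt1 y) ν :=
  Integrable.of_bound (measurable_lt1 y).aestronglyMeasurable 1 (ae_of_all _ fun ξ => by
    rw [Real.norm_eq_abs, abs_of_nonneg (lt1_nonneg _ _)]; exact lt1_le _ _)

/-- pulling back a half line -/
lemma lt1_Tab {α β : ℝ} (hβ : 1 < β) (hα : α ∈ Set.Ico (0:ℝ) 1) {ξ : ℝ} (hξ : ξ ∈ Set.Icc (0:ℝ) 1)
    {y : ℝ} (hy : y ∈ Set.Icc (0:ℝ) 1) :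
    lt1 y (Tab α β ξ) = ∑ k ∈ Finset.range (⌈β⌉₊ + 2), (lt1 ((k + y - α)/β) ξ - lt1 ((k - α)/β) ξ) := by
  have hb : 0 < β := by linarith
  set w := β * ξ + α with hw
  have hw0 : 0 ≤ w := by have := hξ.1; have := hα.1; positivity
  have h1 : ∀ c : ℝ, lt1 ((c - α)/β) ξ = if w < c then 1 else 0 := by
    intro c
    unfold lt1
    congr 1
    rw [lt_div_iff₀ hb, hw]
    apply propext
    constructor <;> intro h <;> linarith
  have hk : ⌊w⌋₊ ∈ Finset.range (⌈β⌉₊ + 2) := by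
    rw [Finset.mem_range, Nat.floor_lt hw0]
    push_cast
    have := Nat.le_ceil β
    have := hξ.2
    have := hα.2
    rw [hw]; nlinarith
  have hfl := Nat.floor_le hw0
  have hfl2 := Nat.lt_floor_add_one w
  rw [Finset.sum_eq_single_of_mem _ hk]
  · rw [h1, h1, if_neg (not_lt.mpr hfl), sub_zero]
    unfold lt1 Tab
    congr 1
    rw [← hw, ← Int.self_sub_floor, ← natCast_floor_eq_intCast_floor hw0]
    apply propext
    constructor <;> intro h <;> linarith
  · intro k _ hne
    rw [h1, h1]
    rcases lt_or_gt_of_ne hne with h | h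
    · have : (k:ℝ) + 1 ≤ ⌊w⌋₊ := by exact_mod_cast h
      rw [if_neg (by linarith [hy.2]), if_neg (by linarith)]; simp
    · have : (⌊w⌋₊:ℝ) + 1 ≤ k := by exact_mod_cast h
      rw [if_pos (by linarith [hy.1]), if_pos (by linarith)]; simp

/-- empirical distribution -/
noncomputable def emp (ξ : ℕ → ℝ) (f : ℝ → ℝ) (n : ℕ) : ℝ := (n:ℝ)⁻¹ * ∑ m ∈ Finset.range n, f (ξ m)

lemma emp_mono {ξ : ℕ → ℝ} {f g : ℝ → ℝ} (h : ∀ m, f (ξ m) ≤ g (ξ m)) (n : ℕ) : emp ξ f n ≤ emp ξ g n := by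
  unfold emp
  gcongr
  exact h _

lemma emp_const {ξ : ℕ → ℝ} {f : ℝ → ℝ} {c : ℝ} (h : ∀ m, f (ξ m) = c) {n : ℕ} (hn : 0 < n) :
    emp ξ f n = c := by
  unfold emp
  simp only [h, Finset.sum_const, Finset.card_range, nsmul_eq_mul]
  have : (n:ℝ) ≠ 0 := by positivity
  field_simp

lemma emp_sub (ξ : ℕ → ℝ) (f g : ℝ → ℝ) (n : ℕ) :
    emp ξ (fun y => f y - g y) n = emp ξ f n - emp ξ g n := by
  unfold emp
  rw [Finset.sum_sub_distrib, mul_sub]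

lemma emp_sum (ξ : ℕ → ℝ) {ι : Type} (s : Finset ι) (f : ι → ℝ → ℝ) (c : ι → ℝ) (n : ℕ) :
    emp ξ (fun y => ∑ i ∈ s, c i * f i y) n = ∑ i ∈ s, c i * emp ξ (f i) n := by
  unfold emp
  rw [Finset.sum_comm, Finset.mul_sum]
  refine Finset.sum_congr rfl fun i _ => ?_
  rw [← Finset.mul_sum]; ring

lemma emp_abs_le {ξ : ℕ → ℝ} {f g : ℝ → ℝ} {ε : ℝ} (hε : 0 ≤ ε) (h : ∀ m, |f (ξ m) - g (ξ m)| ≤ ε) (n : ℕ) :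
    |emp ξ f n - emp ξ g n| ≤ ε := by
  rw [← emp_sub]
  unfold emp
  rcases Nat.eq_zero_or_pos n with hn | hn
  · simp [hn, hε]
  · have hJ : (0:ℝ) < n := by exact_mod_cast hn
    rw [abs_mul, abs_of_pos (by positivity : (0:ℝ) < (n:ℝ)⁻¹), inv_mul_le_iff₀ hJ]
    refine (Finset.abs_sum_le_sum_abs _ _).trans ?_
    exact (Finset.sum_le_card_nsmul _ _ ε fun j _ => h j).trans (by simp)

open scoped Topology ENNReal NNReal

lemma exists_lim_lt1 (ξ : ℕ → ℝ) (U : Ultrafilter ℕ) (y : ℝ) :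
    ∃ L, Tendsto (emp ξ (lt1 y)) U (𝓝 L) := by
  have hmem : ∀ n, emp ξ (lt1 y) n ∈ Set.Icc (0:ℝ) 1 := by
    intro n
    have h0 : 0 ≤ emp ξ (lt1 y) n := by
      unfold emp
      have := Finset.sum_nonneg (s := Finset.range n) fun m _ => lt1_nonneg y (ξ m)
      positivity
    refine ⟨h0, ?_⟩
    have := emp_abs_le (ξ := ξ) (f := lt1 y) (g := fun _ => 0) zero_le_one (fun m => by
      rw [sub_zero, abs_of_nonneg (lt1_nonneg _ _)]; exact lt1_le _ _) n
    have h2 : emp ξ (fun _ => 0) n = 0 := by simp [emp]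
    rw [h2, sub_zero] at this
    exact (le_abs_self _).trans this
  have hc : IsCompact (Set.Icc (0:ℝ) 1) := isCompact_Icc
  have := hc.ultrafilter_le_nhds (U.map (emp ξ (lt1 y))) (by
    rw [le_principal_iff]
    exact Ultrafilter.mem_coe.mpr (Ultrafilter.mem_map.mpr (Filter.univ_mem' hmem)))
  obtain ⟨L, _, hL⟩ := this
  exact ⟨L, hL⟩

lemma good_lip {α β x : ℝ} {D : ℝ} (hD : 0 ≤ D)
    (hK : ∀ a a' : ℚ, a < a' → ∃ K : ℝ, ∀ n : ℕ, ∑ m ∈ Finset.range n,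
      (Set.Ico (a:ℝ) a').indicator (1:ℝ → ℝ) ((Tab α β)^[m] x) ≤ D * (a' - a) * n + K)
    {U : Ultrafilter ℕ} (hU : (U : Filter ℕ) ≤ atTop) {F : ℝ → ℝ}
    (hF : ∀ y, Tendsto (emp (fun m => (Tab α β)^[m] x) (lt1 y)) U (𝓝 (F y)))
    {y y' : ℝ} (hy : y ≤ y') : F y' - F y ≤ D * (y' - y) := by
  set ξ : ℕ → ℝ := fun m => (Tab α β)^[m] x
  have key : ∀ a a' : ℚ, (a:ℝ) < y → y' < a' → F y' - F y ≤ D * (a' - a) := by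
    intro a a' ha ha'
    have hlt : a < a' := by exact_mod_cast (ha.trans_le hy).trans ha'
    obtain ⟨K, hK⟩ := hK a a' hlt
    have ht : Tendsto (fun n : ℕ => D * ((a':ℝ) - a) + K * (n:ℝ)⁻¹) U (𝓝 (D * (a' - a) + K * 0)) :=
      ((tendsto_inv_atTop_nhds_zero_nat.const_mul K).const_add _).mono_left hU
    rw [mul_zero, add_zero] at ht
    refine le_of_tendsto_of_tendsto ((hF y').sub (hF y)) ht ?_
    filter_upwards [hU (eventually_gt_atTop 0)] with n hn
    rw [← emp_sub]
    have hn' : (0:ℝ) < n := by exact_mod_cast hn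
    calc emp ξ (fun z => lt1 y' z - lt1 y z) n ≤ emp ξ ((Set.Ico (a:ℝ) a').indicator (1:ℝ → ℝ)) n := by
          apply emp_mono
          intro m
          unfold lt1
          by_cases h : ξ m ∈ Set.Ico (a:ℝ) a'
          · rw [Set.indicator_of_mem h, Pi.one_apply]
            split_ifs <;> norm_num
          · rw [Set.indicator_of_notMem h]
            rw [Set.mem_Ico, not_and_or, not_le, not_lt] at h
            rcases h with h | h
            · rw [if_pos (by linarith), if_pos (by linarith)]; simp
            · rw [if_neg (by linarith), if_neg (by linarith)]; simp
      _ ≤ (n:ℝ)⁻¹ * (D * (a' - a) * n + K) := by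
          unfold emp
          gcongr
          exact hK n
      _ = _ := by field_simp
  refine le_of_forall_pos_le_add fun ε hε => ?_
  set δ := ε / (2 * (D + 1)) with hδ
  have hδ0 : 0 < δ := by positivity
  obtain ⟨a, ha1, ha2⟩ := exists_rat_btwn (show y - δ < y by linarith)
  obtain ⟨a', hb1, hb2⟩ := exists_rat_btwn (show y' < y' + δ by linarith)
  refine (key a a' ha2 hb1).trans ?_
  have h1 : D * ((a':ℝ) - a) ≤ D * (y' - y + 2 * δ) := by
    apply mul_le_mul_of_nonneg_left _ hD; linarith
  have h2 : 2 * D * δ ≤ ε := by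
    have : 2 * (D + 1) * δ = ε := by rw [hδ]; field_simp
    nlinarith
  nlinarith

lemma emp_lim_sum {ξ : ℕ → ℝ} {U : Ultrafilter ℕ} {ν : Measure ℝ} [IsProbabilityMeasure ν]
    (hF : ∀ y, Tendsto (emp ξ (lt1 y)) U (𝓝 (∫ z, lt1 y z ∂ν)))
    (s : Finset ℕ) (c : ℕ → ℝ) (p q : ℕ → ℝ) :
    Tendsto (emp ξ (fun z => ∑ i ∈ s, c i * (lt1 (p i) z - lt1 (q i) z))) U
      (𝓝 (∫ z, ∑ i ∈ s, c i * (lt1 (p i) z - lt1 (q i) z) ∂ν)) := by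
  have h1 : (emp ξ (fun z => ∑ i ∈ s, c i * (lt1 (p i) z - lt1 (q i) z))) =
      fun n => ∑ i ∈ s, c i * (emp ξ (lt1 (p i)) n - emp ξ (lt1 (q i)) n) := by
    funext n
    rw [emp_sum ξ s (fun i z => lt1 (p i) z - lt1 (q i) z) c n]
    simp only [emp_sub]
  rw [h1, integral_finsetSum]
  · apply tendsto_finsetSum
    intro i _
    rw [integral_const_mul, integral_sub (integrable_lt1 _ _) (integrable_lt1 _ _)]
    exact ((hF _).sub (hF _)).const_mul _
  · intro i _
    exact ((integrable_lt1 _ _).sub (integrable_lt1 _ _)).const_mul _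

lemma emp_shift {T : ℝ → ℝ} {x : ℝ} {U : Ultrafilter ℕ} (hU : (U : Filter ℕ) ≤ atTop) (y : ℝ) {L : ℝ}
    (h : Tendsto (emp (fun m => T^[m] x) (lt1 y)) U (𝓝 L)) :
    Tendsto (emp (fun m => T^[m] x) (fun z => lt1 y (T z))) U (𝓝 L) := by
  set ξ : ℕ → ℝ := fun m => T^[m] x with hξ
  have hz : Tendsto (fun n : ℕ => (n:ℝ)⁻¹ * (lt1 y (ξ n) - lt1 y (ξ 0))) U (𝓝 0) := by
    have h1 : Tendsto (fun n : ℕ => (n:ℝ)⁻¹) U (𝓝 0) := tendsto_inv_atTop_nhds_zero_nat.mono_left hU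
    refine squeeze_zero_norm (fun n => ?_) h1
    rw [norm_mul, Real.norm_eq_abs, Real.norm_eq_abs, abs_of_nonneg (by positivity : (0:ℝ) ≤ (n:ℝ)⁻¹)]
    have : |lt1 y (ξ n) - lt1 y (ξ 0)| ≤ 1 := by
      rw [abs_le]
      constructor <;> linarith [lt1_nonneg y (ξ n), lt1_le y (ξ n), lt1_nonneg y (ξ 0), lt1_le y (ξ 0)]
    exact mul_le_of_le_one_right (by positivity) this
  have := h.add hz
  rw [add_zero] at this
  refine this.congr fun n => ?_
  unfold emp
  rw [← mul_add]
  congr 1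
  have h1 : ∀ m, T (ξ m) = ξ (m+1) := fun m => (Function.iterate_succ_apply' T m x).symm
  simp only [h1]
  have := Finset.sum_range_succ' (fun m => lt1 y (ξ m)) n
  rw [Finset.sum_range_succ] at this
  linarith

lemma inv_of_lim {α β x : ℝ} (hβ : 1 < β) (hα : α ∈ Set.Ico (0:ℝ) 1) (hx : x ∈ Set.Ico (0:ℝ) 1)
    {U : Ultrafilter ℕ} (hU : (U : Filter ℕ) ≤ atTop)
    {ν : Measure ℝ} [IsProbabilityMeasure ν] (hsupp : ∀ᵐ z ∂ν, z ∈ Set.Ico (0:ℝ) 1)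
    (hF : ∀ y, Tendsto (emp (fun m => (Tab α β)^[m] x) (lt1 y)) U (𝓝 (∫ z, lt1 y z ∂ν))) :
    ν.map (Tab α β) = ν := by
  have hm := measurable_Tab α β
  haveI : IsProbabilityMeasure (ν.map (Tab α β)) := Measure.isProbabilityMeasure_map hm.aemeasurable
  have hTI : ∀ z, Tab α β z ∈ Set.Ico (0:ℝ) 1 := fun z => ⟨Int.fract_nonneg _, Int.fract_lt_one _⟩
  have key : ∀ y, ∫ z, lt1 y (Tab α β z) ∂ν = ∫ z, lt1 y z ∂ν := by
    intro y
    rcases lt_or_ge y 0 with hy | hy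
    · apply integral_congr_ae
      filter_upwards [hsupp] with z hz
      unfold lt1
      rw [if_neg (by linarith [(hTI z).1]), if_neg (by linarith [hz.1])]
    rcases lt_or_ge 1 y with hy' | hy'
    · apply integral_congr_ae
      filter_upwards [hsupp] with z hz
      unfold lt1
      rw [if_pos (by linarith [(hTI z).2]), if_pos (by linarith [hz.2])]
    have h1 := emp_shift hU y (hF y)
    have h2 := emp_lim_sum hF (Finset.range (⌈β⌉₊ + 2)) (fun _ => 1) (fun k => (k + y - α)/β) (fun k => (k - α)/β)
    have h3 : ∫ z, ∑ i ∈ Finset.range (⌈β⌉₊ + 2), 1 * (lt1 ((i + y - α)/β) z - lt1 ((i - α)/β) z) ∂ν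
        = ∫ z, lt1 y (Tab α β z) ∂ν := by
      apply integral_congr_ae
      filter_upwards [hsupp] with z hz
      rw [lt1_Tab hβ hα ⟨hz.1, hz.2.le⟩ ⟨hy, hy'⟩]
      simp only [one_mul]
    rw [h3] at h2
    refine tendsto_nhds_unique h2 (h1.congr fun n => ?_)
    unfold emp
    congr 1
    refine Finset.sum_congr rfl fun m _ => ?_
    have hz := iter_mem_Icc α β (y := x) ⟨hx.1, hx.2.le⟩ m
    simp only [one_mul]
    rw [lt1_Tab hβ hα hz ⟨hy, hy'⟩]
  refine ext_of_generate_finite _ (borel_eq_generateFrom_Iio ℝ ▸ (BorelSpace.measurable_eq (α := ℝ))) isPiSystem_Iio ?_ (by simp)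
  rintro _ ⟨y, rfl⟩
  have := key y
  rw [← integral_map hm.aemeasurable (f := lt1 y) (measurable_lt1 y).aestronglyMeasurable,
    integral_lt1, integral_lt1] at this
  exact (measureReal_eq_measureReal_iff).mp this

lemma lim_continuous {ξ : ℕ → ℝ} (hξ : ∀ m, ξ m ∈ Set.Ico (0:ℝ) 1) {U : Ultrafilter ℕ}
    {ν : Measure ℝ} [IsProbabilityMeasure ν] (hsupp : ∀ᵐ z ∂ν, z ∈ Set.Ico (0:ℝ) 1)
    (hF : ∀ y, Tendsto (emp ξ (lt1 y)) U (𝓝 (∫ z, lt1 y z ∂ν)))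
    {f : ℝ → ℝ} (hf : ContinuousOn f (Set.Icc 0 1)) :
    Tendsto (emp ξ f) U (𝓝 (∫ z, f z ∂ν)) := by
  have hfi : Integrable f ν := by
    have hr : ν.restrict (Set.Icc (0:ℝ) 1) = ν := by
      apply Measure.restrict_eq_self_of_ae_mem
      filter_upwards [hsupp] with z hz using ⟨hz.1, hz.2.le⟩
    have := hf.integrableOn_compact (μ := ν) isCompact_Icc
    rwa [IntegrableOn, hr] at this
  have huc := isCompact_Icc.uniformContinuousOn_of_continuous hf
  rw [Metric.tendsto_nhds]
  intro ε hε
  rw [Metric.uniformContinuousOn_iff] at huc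
  obtain ⟨δ, hδ, huc⟩ := huc (ε/3) (by positivity)
  obtain ⟨N, hN⟩ := exists_nat_one_div_lt hδ
  set M : ℕ := N + 1 with hM
  have hM0 : (0:ℝ) < M := by positivity
  have hMδ : 1 / (M:ℝ) < δ := by rw [hM]; push_cast; exact hN
  set s : ℝ → ℝ := fun z => ∑ i ∈ Finset.range M, f (i / M) * (lt1 (((i+1:ℕ):ℝ) / M) z - lt1 ((i:ℝ)/M) z) with hs
  have hclose : ∀ z ∈ Set.Ico (0:ℝ) 1, |f z - s z| ≤ ε/3 := by
    intro z hz
    set k := ⌊z * M⌋₊ with hk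
    have hzM : 0 ≤ z * M := by have := hz.1; positivity
    have hk1 : (k:ℝ) ≤ z * M := Nat.floor_le hzM
    have hk2 : z * M < k + 1 := Nat.lt_floor_add_one _
    have hkM : k ∈ Finset.range M := by
      rw [Finset.mem_range, hk, Nat.floor_lt hzM]; nlinarith [hz.2]
    have hsz : s z = f (k / M) := by
      simp only [hs]
      rw [Finset.sum_eq_single_of_mem _ hkM]
      · unfold lt1
        rw [if_pos, if_neg]
        · simp
        · rw [not_lt, div_le_iff₀ hM0]; exact hk1
        · rw [lt_div_iff₀ hM0]; push_cast; exact hk2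
      · intro i _ hne
        unfold lt1
        rcases lt_or_gt_of_ne hne with h | h
        · have : ((i:ℝ) + 1) ≤ k := by exact_mod_cast h
          rw [if_neg, if_neg]
          · simp
          · rw [not_lt, div_le_iff₀ hM0]; linarith
          · rw [not_lt, div_le_iff₀ hM0]; push_cast; linarith
        · have : ((k:ℝ) + 1) ≤ i := by exact_mod_cast h
          rw [if_pos, if_pos]
          · simp
          · rw [lt_div_iff₀ hM0]; linarith
          · rw [lt_div_iff₀ hM0]; push_cast; linarith
    rw [hsz]
    have hkz : (k:ℝ) / M ≤ z := by rw [div_le_iff₀ hM0]; exact hk1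
    have hzk : z < k / M + 1 / M := by rw [← add_div, lt_div_iff₀ hM0]; exact hk2
    have := huc z ⟨hz.1, hz.2.le⟩ (k / M) ⟨by positivity, hkz.trans hz.2.le⟩ (by
      rw [Real.dist_eq, abs_of_nonneg (by linarith)]; linarith)
    rw [Real.dist_eq] at this
    exact this.le
  have hsl := emp_lim_sum hF (Finset.range M) (fun i => f (i / M)) (fun i => ((i+1:ℕ):ℝ) / M) (fun i => (i:ℝ)/M)
  change Tendsto (emp ξ s) U (𝓝 (∫ z, s z ∂ν)) at hsl
  have hsi : Integrable s ν := by
    apply integrable_finsetSum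
    intro i _
    exact ((integrable_lt1 _ _).sub (integrable_lt1 _ _)).const_mul _
  have hint : |∫ z, f z ∂ν - ∫ z, s z ∂ν| ≤ ε/3 := by
    rw [← integral_sub hfi hsi, ← Real.norm_eq_abs]
    have := norm_integral_le_of_norm_le_const (μ := ν) (f := fun z => f z - s z) (C := ε/3) (by
      filter_upwards [hsupp] with z hz
      exact hclose z hz)
    simpa using this
  rw [Metric.tendsto_nhds] at hsl
  filter_upwards [hsl (ε/3) (by positivity)] with n hn
  have h1 := emp_abs_le (ξ := ξ) (f := f) (g := s) (by positivity : 0 ≤ ε/3) (fun m => hclose _ (hξ m)) n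
  rw [Real.dist_eq] at hn ⊢
  rw [abs_le] at h1 hint
  rw [abs_lt] at hn ⊢
  constructor <;> linarith

lemma good_normal {α β x : ℝ} (hβ : 1 < β) (hα : α ∈ Set.Ico (0:ℝ) 1) (hx : x ∈ Set.Ico (0:ℝ) 1)
    (hg : Good α β x) : IsNormalOrbit (Tab α β) (parryMeasure α β) x := by
  intro f hf
  obtain ⟨D, hD, hK⟩ := hg
  rw [tendsto_iff_ultrafilter]
  intro U hU
  set ξ : ℕ → ℝ := fun m => (Tab α β)^[m] x with hξdef
  have hξ : ∀ m, ξ m ∈ Set.Ico (0:ℝ) 1 := fun m => iter_mem_Ico α β hx m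
  choose F hF using exists_lim_lt1 ξ U
  have hmono : Monotone F := by
    intro y y' h
    refine le_of_tendsto_of_tendsto' (hF y) (hF y') fun n => emp_mono (fun m => ?_) n
    unfold lt1
    split_ifs <;> first | linarith | norm_num
  have h0 : ∀ y ≤ 0, F y = 0 := by
    intro y hy
    refine tendsto_nhds_unique (hF y) (tendsto_const_nhds.congr' ?_)
    filter_upwards [hU (eventually_gt_atTop 0)] with n hn
    refine (emp_const (fun m => ?_) hn).symm
    unfold lt1
    rw [if_neg (by linarith [(hξ m).1])]
  have h1 : ∀ y, 1 ≤ y → F y = 1 := by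
    intro y hy
    refine tendsto_nhds_unique (hF y) (tendsto_const_nhds.congr' ?_)
    filter_upwards [hU (eventually_gt_atTop 0)] with n hn
    refine (emp_const (fun m => ?_) hn).symm
    unfold lt1
    rw [if_pos (by linarith [(hξ m).2])]
  obtain ⟨ν, hp, hac, hs, hν⟩ := stieltjes_limit hD hmono (fun y y' h => good_lip hD hK hU hF h) h0 h1
  have hsupp : ∀ᵐ z ∂ν, z ∈ Set.Ico (0:ℝ) 1 := by
    have e1 : ∀ᵐ z ∂ν, z ∈ Set.Icc (0:ℝ) 1 := hs
    have e2 : ∀ᵐ z ∂ν, z ≠ 1 := hac.ae_le (Measure.ae_ne volume (1:ℝ))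
    filter_upwards [e1, e2] with z hz hz'
    exact ⟨hz.1, lt_of_le_of_ne hz.2 hz'⟩
  have hF' : ∀ y, Tendsto (emp ξ (lt1 y)) U (𝓝 (∫ z, lt1 y z ∂ν)) := by
    intro y
    rw [integral_lt1, hν]
    exact hF y
  have hinv := inv_of_lim hβ hα hx hU hsupp hF'
  rw [← parry_unique hβ hα ν hac hs hinv]
  exact lim_continuous hξ hsupp hF' hf

/-- For `x, α ∈ [0,1)` with `(x,α) ≠ (0,0)`, the set of `β ∈ (1,∞)` for which the orbit of `x`
under `T_{α,β}` fails to be `μ_{α,β}`-normal is a Lebesgue-null set. -/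
theorem normal_for_ae_beta (x α : ℝ) (hx : x ∈ Set.Ico (0 : ℝ) 1)
    (hα : α ∈ Set.Ico (0 : ℝ) 1) (hxα : (x, α) ≠ (0, 0)) :
    volume {β : ℝ | β ∈ Set.Ioi (1 : ℝ) ∧
      ¬ IsNormalOrbit (Tab α β) (parryMeasure α β) x} = 0 := by
  refine measure_mono_null ?_ (ae_good hx hα hxα)
  rintro β ⟨hβ, hn⟩
  exact ⟨hβ, fun hg => hn (good_normal hβ hα hx hg)⟩
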